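/- arXiv:2009.12134 — 2 statements merged into one kernel-verified Lean document; each statement's English description precedes it below -/
import Mathlib

section
/- Let b: [0,T]×ℝ^d → ℝ^d be a bounded Borel vector field satisfying the half-Lipschitz condition (b_t(x)−b_t(y))·(x−y) ≥ −C₀|x−y|² for all x,y,t, and let m̄₀ ∈ P₁(ℝ^d) be absolutely continuous with bounded density. Then there exists a unique solution of the forward continuity equation ∂_t m + div(mb) = 0 on ℝ^d×(0,T), m(0) = m̄₀, among bounded, absolutely continuous (with respect to Lebesgue measure) distributional solutions. -/
open MeasureTheory Filter Set
open scoped ENNReal NNReal Topology RealInnerProductSpace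

noncomputable section

variable (d : ℕ)

local notation "V" => EuclideanSpace ℝ (Fin d)

/-- `b` is a bounded Borel vector field on `[0,T] × ℝ^d` satisfying the half-Lipschitz
condition from below with constant `C₀`:
`(b_t(x) - b_t(y))·(x - y) ≥ -C₀|x - y|²`. -/
structure HalfLipschitzField (T : ℝ) (b : ℝ → V → V) (C₀ : ℝ) : Prop where
  pos : 0 < C₀
  meas : Measurable (Function.uncurry b)
  bdd : ∀ t ∈ Icc (0:ℝ) T, ∀ x : V, ‖b t x‖ ≤ C₀
  halfLip : ∀ t ∈ Icc (0:ℝ) T, ∀ x y : V, ⟪b t x - b t y, x - y⟫ ≥ -C₀ * ‖x - y‖ ^ 2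

/-- The Filippov regularization `b^F` of `b`: the (set-valued) essential convex
closure of `b` in the space variable. -/
def filippov (b : ℝ → V → V) (t : ℝ) (x : V) : Set V :=
  ⋂ δ ∈ Ioi (0:ℝ), ⋂ N ∈ {N : Set V | volume N = 0},
    closure (convexHull ℝ (b t '' (Metric.ball x δ \ N)))

/-- `x` is an absolutely continuous solution of the Filippov differential inclusion
`ẋ_s ∈ b^F_s(x_s)` on the interval `[s₀, s₁]`. -/
def IsFilippovSolOn (b : ℝ → V → V) (x : ℝ → V) (s₀ s₁ : ℝ) : Prop :=
  ∃ g : ℝ → V, IntegrableOn g (Ioc s₀ s₁) ∧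
    (∀ᵐ s ∂(volume.restrict (Ioc s₀ s₁)), g s ∈ filippov d b s (x s)) ∧
    ∀ t ∈ Icc s₀ s₁, x t = x s₀ + ∫ s in Ioc s₀ t, g s

/-- `X` is the backward Filippov flow of `b`: for every `x₀` and `t₀ ∈ [0,T]`,
`X x₀ t₀` solves the backward differential inclusion `ẋ_s ∈ b^F_s(x_s)` on `[0, t₀]`
with `X x₀ t₀ t₀ = x₀`. -/
def IsBackwardFilippovFlow (T : ℝ) (b : ℝ → V → V) (X : V → ℝ → ℝ → V) : Prop :=
  ∀ x₀ : V, ∀ t₀ ∈ Icc (0:ℝ) T,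
    IsFilippovSolOn d b (X x₀ t₀) 0 t₀ ∧ X x₀ t₀ t₀ = x₀

/-- `ρ0` is a probability density on `ℝ^d`. -/
def IsProbDensity (ρ0 : V → ℝ) : Prop :=
  Measurable ρ0 ∧ (∀ x, 0 ≤ ρ0 x) ∧ (∫ x : V, ρ0 x) = 1

/-- A bounded, absolutely continuous (w.r.t. Lebesgue) distributional solution, given by
its densities `ρ_t`, of the forward continuity equation `∂_t m + div(m b) = 0` on
`ℝ^d × (0,T)` with `m(0) = ρ0·dx`. -/
structure IsCtyEqSolDet (T : ℝ) (b : ℝ → V → V) (ρ0 : V → ℝ) (ρ : ℝ → V → ℝ) : Prop where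
  meas : ∀ t, Measurable (ρ t)
  nonneg : ∀ t ∈ Icc (0:ℝ) T, ∀ᵐ x ∂(volume : Measure V), 0 ≤ ρ t x
  bdd : ∃ C : ℝ, 0 < C ∧ ∀ t ∈ Icc (0:ℝ) T, ∀ᵐ x ∂(volume : Measure V), ρ t x ≤ C
  int : ∀ t ∈ Icc (0:ℝ) T, Integrable (ρ t)
  weakEq : ∀ φ : V → ℝ, ContDiff ℝ (⊤ : ℕ∞) φ → HasCompactSupport φ → ∀ t ∈ Icc (0:ℝ) T,
    (∫ x : V, φ x * ρ t x) = (∫ x : V, φ x * ρ0 x)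
      + ∫ s in Ioc (0:ℝ) t, ∫ x : V, ⟪gradient φ x, b s x⟫ * ρ s x

section helpers
variable {d}

theorem aux_lip_vol {L : ℝ≥0} {f : V → V} (hf : LipschitzWith L f) (s : Set V) :
    volume (f '' s) ≤ (L : ℝ≥0∞) ^ d * volume s := by
  have h1 : (volume : Measure V) = (volume : Measure V).addHaarScalarFactor (μH[(Module.finrank ℝ V : ℕ)]) • (μH[(Module.finrank ℝ V : ℕ)] : Measure V) := Measure.isAddLeftInvariant_eq_smul _ _
  have h2 := hf.hausdorffMeasure_image_le (d := (Module.finrank ℝ V : ℕ)) (by positivity) s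
  have h3 : (Module.finrank ℝ V : ℕ) = d := by simp
  rw [h1]
  simp only [Measure.smul_apply, ENNReal.smul_def, smul_eq_mul]
  rw [mul_left_comm]
  gcongr
  refine h2.trans ?_
  rw [ENNReal.rpow_natCast, h3]

theorem aux_unif_lip {L : ℝ≥0} {Φn : ℕ → V → V} {Φ : V → V}
    (hL : ∀ n, LipschitzWith L (Φn n)) (hlim : ∀ x, Tendsto (fun n => Φn n x) atTop (𝓝 (Φ x))) :
    LipschitzWith L Φ := by
  refine LipschitzWith.of_dist_le_mul fun x y => ?_
  exact le_of_tendsto ((hlim x).dist (hlim y)) (Eventually.of_forall fun n => (hL n).dist_le_mul x y)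

theorem aux_unif {L : ℝ≥0} {Φn : ℕ → V → V} {Φ : V → V}
    (hL : ∀ n, LipschitzWith L (Φn n)) (hlim : ∀ x, Tendsto (fun n => Φn n x) atTop (𝓝 (Φ x)))
    (a : V) (r : ℝ) (ε : ℝ) (hε : 0 < ε) :
    ∀ᶠ n in atTop, ∀ z ∈ Metric.closedBall a r, dist (Φn n z) (Φ z) ≤ ε := by
  have hΦ := aux_unif_lip hL hlim
  obtain ⟨t, ht, hcov⟩ := (isCompact_closedBall a r).finite_cover_balls (e := ε / (3 * (L + 1))) (by positivity)
  obtain ⟨htf, hcov⟩ := hcov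
  have h1 : ∀ᶠ n in atTop, ∀ c ∈ t, dist (Φn n c) (Φ c) < ε / 3 := by
    rw [Filter.eventually_all_finite htf]
    intro c hc
    exact (Metric.tendsto_nhds.1 (hlim c)) (ε / 3) (by positivity)
  filter_upwards [h1] with n hn z hz
  have := hcov hz
  simp only [mem_iUnion, Metric.mem_ball] at this
  obtain ⟨c, hc, hzc⟩ := this
  have e1 := (hL n).dist_le_mul z c
  have e2 := hΦ.dist_le_mul c z
  have e3 := hn c hc
  have e4 : dist (Φn n z) (Φ z) ≤ dist (Φn n z) (Φn n c) + dist (Φn n c) (Φ c) + dist (Φ c) (Φ z) := dist_triangle4 _ _ _ _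
  rw [dist_comm c z] at e2
  have e5 : L * dist z c ≤ ε / 3 := by
    have : (L : ℝ) * dist z c ≤ (L + 1) * (ε / (3 * (L + 1))) := by
      gcongr; linarith
    refine this.trans (le_of_eq ?_)
    field_simp
  linarith

/-- the nondegenerate points -/
def Good (Φ : V → V) : Set V := {a | DifferentiableAt ℝ Φ a ∧ (fderiv ℝ Φ a).det ≠ 0}

theorem aux_good_meas (Φ : V → V) : MeasurableSet (Good Φ) := by
  refine (measurableSet_of_differentiableAt ℝ Φ).inter ?_
  have : Measurable fun a => (fderiv ℝ Φ a).det :=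
    (ContinuousLinearMap.continuous_det.measurable).comp (measurable_fderiv ℝ Φ)
  exact (this (measurableSet_singleton 0)).compl

theorem aux_inv_conv {L : ℝ≥0} {Φn Xn : ℕ → V → V} {Φ : V → V}
    (hL : ∀ n, LipschitzWith L (Φn n)) (hlim : ∀ x, Tendsto (fun n => Φn n x) atTop (𝓝 (Φ x)))
    (hX : ∀ n, Continuous (Xn n)) (h1 : ∀ n x, Xn n (Φn n x) = x) (h2 : ∀ n y, Φn n (Xn n y) = y)
    {a : V} (ha : a ∈ Good Φ) : Tendsto (fun n => Xn n (Φ a)) atTop (𝓝 a) := by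
  obtain ⟨hd, hdet⟩ := ha
  set A := fderiv ℝ Φ a with hA
  obtain ⟨c, hc, hcA⟩ : ∃ c > 0, ∀ z, c * ‖z‖ ≤ ‖A z‖ := by
    let e := ContinuousLinearMap.toContinuousLinearEquivOfDetNeZero A hdet
    have := e.antilipschitz
    set K := ‖(e.symm : V →L[ℝ] V)‖₊ with hK
    refine ⟨1 / (K + 1), by positivity, fun z => ?_⟩
    have h := this.le_mul_dist z 0
    simp only [map_zero, dist_zero_right] at h
    have h' : ‖z‖ ≤ K * ‖A z‖ := h
    rw [div_mul_eq_mul_div, one_mul, div_le_iff₀ (by positivity)]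
    nlinarith [norm_nonneg (A z)]
  have hdd := hd.hasFDerivAt
  rw [hasFDerivAt_iff_isLittleO, Asymptotics.isLittleO_iff] at hdd
  obtain ⟨r0, hr0, hball⟩ := Metric.eventually_nhds_iff.1 (hdd (c := c / 4) (by positivity))
  rw [Metric.tendsto_nhds]
  intro r' hr'
  set r := min (r0 / 2) (r' / 2) with hr
  have hrp : 0 < r := by positivity
  have hrr0 : r < r0 := lt_of_le_of_lt (min_le_left _ _) (by linarith)
  have hrr' : r < r' := lt_of_le_of_lt (min_le_right _ _) (by linarith)
  have hsph : ∀ z, dist z a = r → 3 / 4 * c * r ≤ dist (Φ z) (Φ a) := by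
    intro z hz
    have h := hball (y := z) (by rw [hz]; exact hrr0)
    have h' := hcA (z - a)
    rw [dist_eq_norm] at hz
    rw [hz] at h h'
    rw [dist_eq_norm]
    have : ‖A (z - a)‖ ≤ ‖Φ z - Φ a‖ + ‖Φ z - Φ a - A (z - a)‖ := by
      have := norm_sub_le (Φ z - Φ a) (Φ z - Φ a - A (z - a))
      simpa using this
    linarith
  filter_upwards [aux_unif hL hlim a r (c * r / 4) (by positivity)] with n hn
  by_contra hcon
  push Not at hcon
  let γ : ℝ → V := fun τ => AffineMap.lineMap (Φn n a) (Φ a) τ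
  have hγ : Continuous γ := AffineMap.lineMap_continuous
  have hcont : ContinuousOn (fun τ => dist (Xn n (γ τ)) a) (Icc 0 1) :=
    (((hX n).comp hγ).dist continuous_const).continuousOn
  have hivt := intermediate_value_Icc (zero_le_one) hcont
  have hmem : r ∈ Icc (dist (Xn n (γ 0)) a) (dist (Xn n (γ 1)) a) := by
    constructor
    · simp [γ, h1, hrp.le]
    · simp only [γ, AffineMap.lineMap_apply_one]; linarith
  obtain ⟨τ, hτ, hτr⟩ := hivt hmem
  simp only at hτr
  have e1 := hsph _ hτr
  have e2 := hn _ (by rw [Metric.mem_closedBall, hτr])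
  rw [h2] at e2
  have e3 := hn a (Metric.mem_closedBall_self hrp.le)
  have e4 : dist (γ τ) (Φ a) ≤ dist (Φn n a) (Φ a) := by
    simp only [γ, dist_lineMap_right]
    have : ‖1 - τ‖ ≤ 1 := by
      rw [Real.norm_eq_abs, abs_le]; constructor <;> linarith [hτ.1, hτ.2]
    nlinarith [dist_nonneg (x := Φn n a) (y := Φ a)]
  have e5 := dist_triangle (Φ (Xn n (γ τ))) (γ τ) (Φ a)
  rw [dist_comm (Φ (Xn n (γ τ))) (γ τ)] at e5
  nlinarith [mul_pos hc hrp]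

theorem aux_degenerate {L : ℝ≥0} {Φ : V → V} (hL : LipschitzWith L Φ) :
    volume (Φ '' (Good Φ)ᶜ) = 0 := by
  have h1 : volume (Φ '' {x | ¬ DifferentiableAt ℝ Φ x}) = 0 := by
    have := aux_lip_vol hL {x | ¬ DifferentiableAt ℝ Φ x}
    have h0 : volume {x | ¬ DifferentiableAt ℝ Φ x} = 0 := hL.ae_differentiableAt
    rw [h0, mul_zero] at this
    exact le_antisymm this bot_le
  have h2 : volume (Φ '' {x | DifferentiableAt ℝ Φ x ∧ (fderiv ℝ Φ x).det = 0}) = 0 :=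
    addHaar_image_eq_zero_of_det_fderivWithin_eq_zero volume (f' := fderiv ℝ Φ)
      (fun x hx => hx.1.hasFDerivAt.hasFDerivWithinAt) (fun x hx => hx.2)
  refine measure_mono_null ?_ (measure_union_null h1 h2)
  rw [← image_union]
  apply image_mono
  intro x hx
  by_cases h : DifferentiableAt ℝ Φ x
  · right; exact ⟨h, by by_contra h'; exact hx ⟨h, h'⟩⟩
  · left; exact h

theorem aux_surj {L : ℝ≥0} {Φn Xn : ℕ → V → V} {Φ : V → V}
    (hL : ∀ n, LipschitzWith L (Φn n)) (hlim : ∀ x, Tendsto (fun n => Φn n x) atTop (𝓝 (Φ x)))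
    (h2 : ∀ n y, Φn n (Xn n y) = y) {D : ℝ} (hD : ∀ n y, dist (Xn n y) y ≤ D) (y : V) :
    ∃ a, Φ a = y := by
  obtain ⟨a, -, φ, hφ, ha⟩ := (isCompact_closedBall y D).tendsto_subseq (x := fun n => Xn n y) (fun n => hD n y)
  refine ⟨a, ?_⟩
  have h3 : Tendsto (fun n => Φn (φ n) a) atTop (𝓝 (Φ a)) := (hlim a).comp hφ.tendsto_atTop
  have h4 : Tendsto (fun n => dist (Φn (φ n) a) y) atTop (𝓝 0) := by
    have : Tendsto (fun n => (L : ℝ) * dist a (Xn (φ n) y)) atTop (𝓝 (L * dist a a)) :=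
      (tendsto_const_nhds.dist ha).const_mul _
    rw [dist_self, mul_zero] at this
    refine squeeze_zero (fun n => dist_nonneg) (fun n => ?_) this
    have := (hL (φ n)).dist_le_mul a (Xn (φ n) y)
    rwa [h2] at this
  exact tendsto_nhds_unique h3 (tendsto_iff_dist_tendsto_zero.2 h4)

theorem aux_unique {L : ℝ≥0} {Φ : V → V} (hL : LipschitzWith L Φ) (hinj : InjOn Φ (Good Φ))
    {μ1 μ2 ν : Measure V} (hν : ν ≪ volume)
    (h1 : μ1.map Φ = ν) (h2 : μ2.map Φ = ν) : μ1 = μ2 := by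
  have key : ∀ μ : Measure V, μ.map Φ = ν → ∀ s, MeasurableSet s → μ s = ν (Φ '' (s ∩ Good Φ)) := by
    intro μ hμ s hs
    have hΦ : Measurable Φ := hL.continuous.measurable
    have hbad : μ (Good Φ)ᶜ = 0 := by
      have : μ.map Φ (Φ '' (Good Φ)ᶜ) = 0 := by rw [hμ]; exact hν (aux_degenerate hL)
      exact measure_mono_null (subset_preimage_image Φ _) (Measure.preimage_null_of_map_null hΦ.aemeasurable this)
    have hm : MeasurableSet (Φ '' (s ∩ Good Φ)) :=
      (hs.inter (aux_good_meas Φ)).image_of_measurable_injOn hΦ (hinj.mono inter_subset_right)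
    rw [← hμ, Measure.map_apply hΦ hm]
    refine measure_congr ?_
    have hae : ∀ᵐ x ∂μ, x ∈ Good Φ := hbad
    filter_upwards [hae] with x hx
    apply propext
    constructor
    · intro h; exact ⟨x, ⟨h, hx⟩, rfl⟩
    · rintro ⟨z, ⟨hz, hzg⟩, hzx⟩
      have := hinj hzg hx hzx
      rw [← this]; exact hz
  ext s hs
  rw [key μ1 h1 s hs, key μ2 h2 s hs]

end helpers

section helpers2
variable {d}

theorem aux_mollify {T C₀ : ℝ} {b : ℝ → V → V} (hb : HalfLipschitzField d T b C₀) :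
    ∃ B : ℕ → ℝ × V → V, (∀ n, ContDiff ℝ (⊤ : ℕ∞) (B n)) ∧ (∀ n p, ‖B n p‖ ≤ C₀) ∧
      (∀ n t x y, ⟪B n (t, x) - B n (t, y), x - y⟫ ≥ -C₀ * ‖x - y‖ ^ 2) ∧
      (∀ n, ∃ K : ℝ≥0, LipschitzWith K (B n)) ∧
      (∀ᵐ s ∂(volume.restrict (Ioc 0 T)), ∀ᵐ x ∂(volume : Measure V),
        Tendsto (fun n => B n (s, x)) atTop (𝓝 (b s x))) := by
  classical
  obtain ⟨hpos, hmeas, hbdd, hhl⟩ := hb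
  have : (volume : Measure (ℝ × V)).IsAddHaarMeasure :=
    inferInstanceAs ((volume : Measure ℝ).prod (volume : Measure V)).IsAddHaarMeasure
  let g : ℝ × V → V := fun p => if p.1 ∈ Icc (0:ℝ) T then b p.1 p.2 else 0
  have hgm : Measurable g :=
    Measurable.ite (measurable_fst measurableSet_Icc) hmeas measurable_const
  have hgb : ∀ p, ‖g p‖ ≤ C₀ := by
    intro p
    by_cases h : p.1 ∈ Icc (0:ℝ) T
    · simp only [g, h, if_true]; exact hbdd _ h _
    · simp only [g, h, if_false, norm_zero]; exact hpos.le
  have hghl : ∀ t x y, ⟪g (t, x) - g (t, y), x - y⟫ ≥ -C₀ * ‖x - y‖ ^ 2 := by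
    intro t x y
    by_cases h : t ∈ Icc (0:ℝ) T
    · simp only [g, h, if_true]; exact hhl _ h _ _
    · simp only [g, h, if_false, sub_zero, inner_zero_left]
      nlinarith [sq_nonneg ‖x - y‖]
  have hgli : LocallyIntegrable g (volume : Measure (ℝ × V)) := by
    intro p
    obtain ⟨u, hu, hu'⟩ := (volume : Measure (ℝ × V)).finiteAt_nhds p
    refine ⟨u, hu, ?_⟩
    exact IntegrableOn.of_bound hu' hgm.aestronglyMeasurable C₀ (Eventually.of_forall hgb)
  let φ : ℕ → ContDiffBump (0 : ℝ × V) := fun n =>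
    { rIn := 1 / ((n:ℝ) + 1), rOut := 2 / ((n:ℝ) + 1), rIn_pos := by positivity,
      rIn_lt_rOut := by gcongr; norm_num }
  let η : ℕ → ℝ × V → ℝ := fun n => (φ n).normed volume
  have hηint : ∀ n, Integrable (η n) volume := fun n => (φ n).integrable_normed
  have hη1 : ∀ n, ∫ z, η n z = 1 := fun n => (φ n).integral_normed
  have hη0 : ∀ n z, 0 ≤ η n z := fun n z => (φ n).nonneg_normed z
  let B : ℕ → ℝ × V → V := fun n => convolution (η n) g (ContinuousLinearMap.lsmul ℝ ℝ) volume
  have hB : ∀ n p, B n p = ∫ z, η n z • g (p - z) := fun n p => by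
    simp only [B, convolution_def, ContinuousLinearMap.lsmul_apply]
  have hint : ∀ n p, Integrable (fun z => η n z • g (p - z)) volume := by
    intro n p
    have := (hηint n).smul_bdd (f := fun z => g (p - z)) (C₀) 
      (hgm.comp (measurable_const.sub measurable_id)).aestronglyMeasurable
      (Eventually.of_forall fun z => hgb _)
    exact this
  refine ⟨B, ?_, ?_, ?_, ?_, ?_⟩
  · intro n
    exact (φ n).hasCompactSupport_normed.contDiff_convolution_left _ (φ n).contDiff_normed hgli
  · intro n p
    rw [hB]
    calc ‖∫ z, η n z • g (p - z)‖ ≤ ∫ z, η n z * C₀ := by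
          refine norm_integral_le_of_norm_le ((hηint n).mul_const _) (Eventually.of_forall fun z => ?_)
          rw [norm_smul, Real.norm_of_nonneg (hη0 n z)]
          exact mul_le_mul_of_nonneg_left (hgb _) (hη0 n z)
      _ = C₀ := by rw [integral_mul_const, hη1, one_mul]
  · intro n t x y
    rw [hB, hB, ← integral_sub (hint n _) (hint n _), real_inner_comm,
      ← integral_inner (f := fun z => η n z • g ((t, x) - z) - η n z • g ((t, y) - z))
        ((hint n _).sub (hint n _))]
    have : -C₀ * ‖x - y‖ ^ 2 = ∫ z, η n z * (-C₀ * ‖x - y‖ ^ 2) := by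
      rw [integral_mul_const, hη1, one_mul]
    rw [this]
    refine integral_mono ((hηint n).mul_const _) (((hint n _).sub (hint n _)).const_inner _) fun z => ?_
    simp only
    rw [← smul_sub, real_inner_smul_right]
    refine mul_le_mul_of_nonneg_left ?_ (hη0 n z)
    have := hghl (t - z.1) (x - z.2) (y - z.2)
    rw [real_inner_comm]
    have e1 : ∀ q : V, (t, q) - z = (t - z.1, q - z.2) := fun q => rfl
    rw [e1, e1]
    simpa using this
  · intro n
    have hcd : ContDiff ℝ 1 (η n) := (φ n).contDiff_normed
    have hcs : HasCompactSupport (η n) := (φ n).hasCompactSupport_normed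
    have hD : Continuous (fderiv ℝ (η n)) := hcd.continuous_fderiv (by norm_num)
    have hDs : HasCompactSupport (fderiv ℝ (η n)) := hcs.fderiv (𝕜 := ℝ)
    have hDi : Integrable (fderiv ℝ (η n)) volume := hD.integrable_of_hasCompactSupport hDs
    refine ⟨Real.toNNReal (∫ z, ‖fderiv ℝ (η n) z‖ * C₀), ?_⟩
    have hder : ∀ p, HasFDerivAt (B n) (convolution (fderiv ℝ (η n)) g (ContinuousLinearMap.precompL (ℝ × V) (ContinuousLinearMap.lsmul ℝ ℝ : ℝ →L[ℝ] V →L[ℝ] V)) volume p) p := fun p =>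
      hcs.hasFDerivAt_convolution_left _ hcd hgli p
    refine lipschitzWith_of_nnnorm_fderiv_le (𝕜 := ℝ) (fun p => (hder p).differentiableAt) fun p => ?_
    rw [(hder p).fderiv, ← NNReal.coe_le_coe, coe_nnnorm]
    refine le_trans ?_ (Real.le_coe_toNNReal _)
    rw [convolution_def]
    refine norm_integral_le_of_norm_le (hDi.norm.mul_const _) (Eventually.of_forall fun z => ?_)
    refine ContinuousLinearMap.opNorm_le_bound _ (mul_nonneg (norm_nonneg _) hpos.le) fun q => ?_
    rw [ContinuousLinearMap.precompL_apply, ContinuousLinearMap.lsmul_apply, norm_smul]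
    calc ‖fderiv ℝ (η n) z q‖ * ‖g (p - z)‖ ≤ (‖fderiv ℝ (η n) z‖ * ‖q‖) * C₀ :=
          mul_le_mul (ContinuousLinearMap.le_opNorm _ _) (hgb _) (norm_nonneg _) (by positivity)
      _ = _ := by ring
  · have h1 : Tendsto (fun n => (φ n).rOut) atTop (𝓝 0) := by
      have : Tendsto (fun n : ℕ => 2 * (1 / ((n:ℝ) + 1))) atTop (𝓝 (2 * 0)) :=
        tendsto_one_div_add_atTop_nhds_zero_nat.const_mul 2
      rw [mul_zero] at this
      refine this.congr fun n => ?_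
      simp only [φ]; ring
    have h2 := ContDiffBump.ae_convolution_tendsto_right_of_locallyIntegrable (K := 2) h1
      (Eventually.of_forall fun n => by simp only [φ]; apply le_of_eq; ring) hgli
    have h3 := Measure.ae_ae_of_ae_prod (μ := (volume : Measure ℝ)) (ν := (volume : Measure V)) h2
    rw [ae_restrict_iff' measurableSet_Ioc]
    filter_upwards [h3] with s hs hsT
    filter_upwards [hs] with x hx
    have : g (s, x) = b s x := by simp only [g]; rw [if_pos ⟨hsT.1.le, hsT.2⟩]
    rw [← this]
    exact hx

end helpers2

section helpers3
variable {d}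

theorem aux_step_homeo {v : V → V} {h K : ℝ} (hh : 0 ≤ h) (hK : 0 ≤ K) (hhK : h * K ≤ 1 / 2)
    (hv : ∀ x y, ‖v x - v y‖ ≤ K * ‖x - y‖) : ∃ e : V ≃ₜ V, ∀ x, e x = x - h • v x := by
  have happ : ApproximatesLinearOn (fun x => x - h • v x)
      ((ContinuousLinearEquiv.refl ℝ V : V ≃L[ℝ] V) : V →L[ℝ] V) univ (1 / 2 : ℝ≥0) := by
    intro x _ y _
    have h1 : x - h • v x - (y - h • v y) - ((ContinuousLinearEquiv.refl ℝ V : V ≃L[ℝ] V) : V →L[ℝ] V) (x - y)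
        = - (h • (v x - v y)) := by
      simp only [ContinuousLinearEquiv.coe_refl, ContinuousLinearMap.coe_id', id, smul_sub]
      abel
    rw [h1, norm_neg, norm_smul, Real.norm_of_nonneg hh]
    have := mul_le_mul_of_nonneg_left (hv x y) hh
    have h2 : h * (K * ‖x - y‖) ≤ 1 / 2 * ‖x - y‖ := by
      rw [← mul_assoc]; gcongr
    push_cast
    linarith
  have hc : Subsingleton V ∨ (1 / 2 : ℝ≥0) <
      ‖(((ContinuousLinearEquiv.refl ℝ V : V ≃L[ℝ] V)).symm : V →L[ℝ] V)‖₊⁻¹ := by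
    rcases subsingleton_or_nontrivial V with h | h
    · exact Or.inl h
    · right
      have : ‖(((ContinuousLinearEquiv.refl ℝ V : V ≃L[ℝ] V)).symm : V →L[ℝ] V)‖₊ = 1 := by
        rw [← NNReal.coe_inj, coe_nnnorm]
        simp [ContinuousLinearMap.norm_id]
      rw [this]; norm_num
  exact ⟨happ.toHomeomorph _ hc, fun x => rfl⟩

theorem aux_step_lip {v : V → V} {h K C : ℝ} (hh : 0 ≤ h) (hK : 0 ≤ K) (hC : 0 ≤ C)
    (hhK : h * K ^ 2 ≤ C)
    (hv : ∀ x y, ‖v x - v y‖ ≤ K * ‖x - y‖)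
    (hl : ∀ x y, ⟪v x - v y, x - y⟫ ≥ -C * ‖x - y‖ ^ 2) (x y : V) :
    ‖(x - h • v x) - (y - h • v y)‖ ≤ Real.exp (3 * C * h) * ‖x - y‖ := by
  have h1 : (x - h • v x) - (y - h • v y) = (x - y) - h • (v x - v y) := by
    rw [smul_sub]; abel
  rw [h1]
  have h2 : ‖(x - y) - h • (v x - v y)‖ ^ 2 ≤ ((1 + 3 * C * h) * ‖x - y‖) ^ 2 := by
    rw [norm_sub_sq_real, real_inner_smul_right, norm_smul, Real.norm_of_nonneg hh]
    have a1 := hl x y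
    rw [real_inner_comm] at a1
    have a2 : (h * ‖v x - v y‖) ^ 2 ≤ h * C * ‖x - y‖ ^ 2 := by
      calc (h * ‖v x - v y‖) ^ 2 ≤ (h * (K * ‖x - y‖)) ^ 2 := by
            gcongr; exact hv x y
        _ = h * (h * K ^ 2) * ‖x - y‖ ^ 2 := by ring
        _ ≤ h * C * ‖x - y‖ ^ 2 := by gcongr
    have a3 : h * ⟪x - y, v x - v y⟫ ≥ h * (-C * ‖x - y‖ ^ 2) := mul_le_mul_of_nonneg_left a1 hh
    have a4 : 0 ≤ C * h * ‖x - y‖ ^ 2 := by positivity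
    have a5 : 0 ≤ (C * h) ^ 2 * ‖x - y‖ ^ 2 := by positivity
    nlinarith
  have h3 := abs_le_of_sq_le_sq h2 (by positivity)
  have h4 := (le_abs_self _).trans h3
  refine h4.trans ?_
  gcongr
  linarith [Real.add_one_le_exp (3 * C * h)]

/-- data of a discrete approximate flow -/
structure EulerData (C₀ T : ℝ) (L : ℝ≥0) (h K : ℝ) (v Φ X : ℕ → V → V) : Prop where
  h_pos : 0 < h
  K_nn : 0 ≤ K
  v_smooth : ∀ k, ContDiff ℝ (⊤ : ℕ∞) (v k)
  v_bdd : ∀ k x, ‖v k x‖ ≤ C₀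
  v_lip : ∀ k x y, ‖v k x - v k y‖ ≤ K * ‖x - y‖
  phi0 : ∀ x, Φ 0 x = x
  phiS : ∀ k x, Φ (k + 1) x = Φ k (x - h • v (k + 1) x)
  phi_smooth : ∀ k, ContDiff ℝ (⊤ : ℕ∞) (Φ k)
  phi_lip : ∀ k : ℕ, k * h ≤ T → LipschitzWith L (Φ k)
  phi_disp : ∀ (k : ℕ) x, ‖Φ k x - x‖ ≤ C₀ * (k * h)
  phi_time : ∀ (k j : ℕ) x, k * h ≤ T → ‖Φ (k + j) x - Φ k x‖ ≤ L * (C₀ * (j * h))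
  X_cont : ∀ k, Continuous (X k)
  XPhi : ∀ k x, X k (Φ k x) = x
  PhiX : ∀ k y, Φ k (X k y) = y
  X_step : ∀ k y, X k y = X (k + 1) y - h • v (k + 1) (X (k + 1) y)
  grid : ∃ N : ℕ, N * h = T

theorem aux_euler {C₀ T h K : ℝ} (hC : 0 ≤ C₀) (hh : 0 < h) (hK : 0 ≤ K) (hhK : h * K ≤ 1 / 2)
    (hhK2 : h * K ^ 2 ≤ C₀) (hgrid : ∃ N : ℕ, N * h = T) {v : ℕ → V → V}
    (hs : ∀ k, ContDiff ℝ (⊤ : ℕ∞) (v k)) (hb : ∀ k x, ‖v k x‖ ≤ C₀)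
    (hv : ∀ k x y, ‖v k x - v k y‖ ≤ K * ‖x - y‖)
    (hl : ∀ k x y, ⟪v k x - v k y, x - y⟫ ≥ -C₀ * ‖x - y‖ ^ 2) :
    ∃ Φ X : ℕ → V → V, EulerData C₀ T (Real.toNNReal (Real.exp (3 * C₀ * T))) h K v Φ X := by
  choose e he using fun k => aux_step_homeo hh.le hK hhK (hv k)
  let F : ℕ → V ≃ₜ V := fun k => Nat.rec (Homeomorph.refl V) (fun k f => (e (k + 1)).trans f) k
  have F0 : ∀ x, F 0 x = x := fun x => rfl
  have FS : ∀ k x, F (k + 1) x = F k (x - h • v (k + 1) x) := by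
    intro k x
    change F k (e (k + 1) x) = _
    rw [he]
  have hlip : ∀ (k : ℕ) x y, ‖F k x - F k y‖ ≤ Real.exp (3 * C₀ * (k * h)) * ‖x - y‖ := by
    intro k
    induction k with
    | zero => intro x y; simp [F0]
    | succ k ih =>
      intro x y
      rw [FS, FS]
      refine (ih _ _).trans ?_
      have := aux_step_lip hh.le hK hC hhK2 (hv (k + 1)) (hl (k + 1)) x y
      calc _ ≤ Real.exp (3 * C₀ * (k * h)) * (Real.exp (3 * C₀ * h) * ‖x - y‖) := by gcongr
        _ = _ := by rw [← mul_assoc, ← Real.exp_add]; congr 2; push_cast; ring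
  have hlipT : ∀ k : ℕ, k * h ≤ T → ∀ x y, ‖F k x - F k y‖ ≤ Real.exp (3 * C₀ * T) * ‖x - y‖ := by
    intro k hk x y
    refine (hlip k x y).trans ?_
    gcongr
  have hQ : ∀ (k j : ℕ) x, ∃ z, F (k + j) x = F k z ∧ ‖z - x‖ ≤ C₀ * (j * h) := by
    intro k j
    induction j with
    | zero => intro x; exact ⟨x, rfl, by simp⟩
    | succ j ih =>
      intro x
      obtain ⟨z, hz1, hz2⟩ := ih (x - h • v (k + j + 1) x)
      refine ⟨z, ?_, ?_⟩
      · rw [← hz1, ← FS]; rfl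
      · have : z - x = (z - (x - h • v (k + j + 1) x)) - h • v (k + j + 1) x := by abel
        rw [this]
        refine (norm_sub_le _ _).trans ?_
        rw [norm_smul, Real.norm_of_nonneg hh.le]
        have := mul_le_mul_of_nonneg_left (hb (k + j + 1) x) hh.le
        push_cast
        linarith
  refine ⟨fun k => F k, fun k => (F k).symm, hh, hK, hs, hb, hv, F0, FS, ?_, ?_, ?_, ?_, ?_, ?_, ?_, ?_, hgrid⟩
  · intro k
    induction k with
    | zero => exact contDiff_id
    | succ k ih =>
      have : (fun x => F (k + 1) x) = fun x => F k (x - h • v (k + 1) x) := funext (FS k)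
      change ContDiff ℝ _ (fun x => F (k + 1) x)
      rw [this]
      exact ih.comp (contDiff_id.sub ((hs (k + 1)).const_smul h))
  · intro k hk
    refine LipschitzWith.of_dist_le_mul fun x y => ?_
    rw [dist_eq_norm, dist_eq_norm, Real.coe_toNNReal _ (Real.exp_pos _).le]
    exact hlipT k hk x y
  · intro k x
    obtain ⟨z, hz1, hz2⟩ := hQ 0 k x
    rw [zero_add, F0] at hz1
    rw [hz1]; exact hz2
  · intro k j x hk
    obtain ⟨z, hz1, hz2⟩ := hQ k j x
    rw [hz1, Real.coe_toNNReal _ (Real.exp_pos _).le]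
    refine (hlipT k hk _ _).trans ?_
    gcongr
  · intro k; exact (F k).symm.continuous
  · intro k x; exact (F k).symm_apply_apply x
  · intro k x; exact (F k).apply_symm_apply x
  · intro k y
    apply (F k).injective
    rw [(F k).apply_symm_apply, ← FS, (F (k + 1)).apply_symm_apply]

theorem aux_ceil {h T s : ℝ} (hh : 0 < h) (hgrid : ∃ N : ℕ, N * h = T) (hs : s ≤ T) :
    (⌈s / h⌉₊ : ℝ) * h ≤ T := by
  obtain ⟨N, hN⟩ := hgrid
  rw [← hN]
  gcongr
  apply Nat.ceil_le.2
  rw [div_le_iff₀ hh, hN]; exact hs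

theorem aux_time {C₀ T : ℝ} {L : ℝ≥0} {h K : ℝ} {v Φ X : ℕ → V → V} (hC : 0 ≤ C₀)
    (H : EulerData C₀ T L h K v Φ X) {s s' : ℝ} (hs : 0 ≤ s) (hss : s ≤ s') (hsT : s' ≤ T) (x : V) :
    ‖Φ ⌈s' / h⌉₊ x - Φ ⌈s / h⌉₊ x‖ ≤ L * (C₀ * (s' - s + h)) := by
  have hh := H.h_pos
  have hle : ⌈s / h⌉₊ ≤ ⌈s' / h⌉₊ := Nat.ceil_le_ceil (by gcongr)
  obtain ⟨j, hj⟩ := Nat.exists_eq_add_of_le hle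
  rw [hj]
  refine (H.phi_time _ j x (aux_ceil hh H.grid (hss.trans hsT))).trans ?_
  gcongr
  have h1 : (⌈s' / h⌉₊ : ℝ) < s' / h + 1 := Nat.ceil_lt_add_one (by have := hs.trans hss; positivity)
  have h2 : s / h ≤ (⌈s / h⌉₊ : ℝ) := Nat.le_ceil _
  have h3 : (⌈s' / h⌉₊ : ℝ) = ⌈s / h⌉₊ + j := by rw [hj]; push_cast; rfl
  have h4 : (j : ℝ) ≤ s' / h - s / h + 1 := by linarith
  calc (j : ℝ) * h ≤ (s' / h - s / h + 1) * h := by gcongr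
    _ = _ := by field_simp

end helpers3

section helpers4
variable {d}

theorem aux_approx0 {T C₀ : ℝ} (hT : 0 < T) {b : ℝ → V → V} (hb : HalfLipschitzField d T b C₀) :
    ∃ (L : ℝ≥0) (h K : ℕ → ℝ) (v Φ X : ℕ → ℕ → V → V),
      (∀ n, EulerData C₀ T L (h n) (K n) (v n) (Φ n) (X n)) ∧
      Tendsto h atTop (𝓝 0) ∧ Tendsto (fun n => h n * K n) atTop (𝓝 0) ∧
      (∀ᵐ s ∂(volume.restrict (Ioc 0 T)), ∀ᵐ x ∂(volume : Measure V),
        Tendsto (fun n => v n ⌈s / h n⌉₊ x) atTop (𝓝 (b s x))) := by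
  have hpos := hb.pos
  obtain ⟨B, Bs, Bb, Bh, Bl, Bt⟩ := aux_mollify hb
  choose K0 hK0 using Bl
  let K : ℕ → ℝ := fun n => max (K0 n) 1
  have hK1 : ∀ n, 1 ≤ K n := fun n => le_max_right _ _
  have hKl : ∀ n p q, ‖B n p - B n q‖ ≤ K n * ‖p - q‖ := by
    intro n p q
    have := (hK0 n).dist_le_mul p q
    rw [dist_eq_norm, dist_eq_norm] at this
    refine this.trans ?_
    gcongr
    exact le_max_left _ _
  have hN : ∀ n : ℕ, ∃ N : ℕ, 0 < N ∧ T / N * K n ^ 2 ≤ min C₀ (1 / ((n:ℝ) + 2)) := by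
    intro n
    have hm : 0 < min C₀ (1 / ((n:ℝ) + 2)) := by positivity
    obtain ⟨N, hN⟩ := exists_nat_gt (T * K n ^ 2 / min C₀ (1 / ((n:ℝ) + 2)))
    have hK0 : 0 < K n := lt_of_lt_of_le one_pos (hK1 n)
    have hNp : (0:ℝ) < N := lt_trans (by positivity) hN
    refine ⟨N, by exact_mod_cast hNp, ?_⟩
    rw [div_lt_iff₀ hm] at hN
    rw [div_mul_eq_mul_div, div_le_iff₀ hNp]
    linarith
  choose N hNpos hNle using hN
  let h : ℕ → ℝ := fun n => T / N n
  have hh : ∀ n, 0 < h n := fun n => div_pos hT (by exact_mod_cast hNpos n)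
  have hle1 : ∀ n, h n * K n ^ 2 ≤ 1 / ((n:ℝ) + 2) := fun n => (hNle n).trans (min_le_right _ _)
  have hle2 : ∀ n, h n * K n ≤ 1 / ((n:ℝ) + 2) := fun n => by
    refine le_trans ?_ (hle1 n)
    refine mul_le_mul_of_nonneg_left ?_ (hh n).le
    nlinarith [hK1 n]
  have hle3 : ∀ n, h n ≤ 1 / ((n:ℝ) + 2) := fun n => by
    refine le_trans ?_ (hle2 n)
    nlinarith [hK1 n, hh n]
  have hz : Tendsto (fun n : ℕ => 1 / ((n:ℝ) + 2)) atTop (𝓝 0) := by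
    have := (tendsto_add_atTop_iff_nat 1).2 (tendsto_one_div_add_atTop_nhds_zero_nat (𝕜 := ℝ))
    refine this.congr fun n => ?_
    push_cast; congr 1; ring
  have hK0 : ∀ n, 0 ≤ K n := fun n => zero_le_one.trans (hK1 n)
  have hhz : Tendsto h atTop (𝓝 0) := squeeze_zero (fun n => (hh n).le) hle3 hz
  have hhKz : Tendsto (fun n => h n * K n) atTop (𝓝 0) :=
    squeeze_zero (fun n => mul_nonneg (hh n).le (hK0 n)) hle2 hz
  let v : ℕ → ℕ → V → V := fun n k x => B n (k * h n, x)
  have hex : ∀ n, ∃ Φ X : ℕ → V → V,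
      EulerData C₀ T (Real.toNNReal (Real.exp (3 * C₀ * T))) (h n) (K n) (v n) Φ X := by
    intro n
    refine aux_euler hpos.le (hh n) (hK0 n) ?_ ((hNle n).trans (min_le_left _ _)) ?_ ?_ ?_ ?_ ?_
    · refine (hle2 n).trans ?_
      gcongr; linarith [(Nat.cast_nonneg n : (0:ℝ) ≤ n)]
    · refine ⟨N n, ?_⟩
      have : (0:ℝ) < N n := by exact_mod_cast hNpos n
      simp only [h]; field_simp
    · intro k
      exact (Bs n).comp (contDiff_const.prodMk contDiff_id)
    · intro k x; exact Bb n _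
    · intro k x y
      refine (hKl n _ _).trans (le_of_eq ?_)
      congr 1
      simp [Prod.norm_def]
    · intro k x y; exact Bh n _ x y
  choose Φ X hE using hex
  refine ⟨_, h, K, v, Φ, X, hE, hhz, hhKz, ?_⟩
  rw [ae_restrict_iff' measurableSet_Ioc] at Bt ⊢
  filter_upwards [Bt] with s hs hsT
  filter_upwards [hs hsT] with x hx
  have hd : Tendsto (fun n => v n ⌈s / h n⌉₊ x - B n (s, x)) atTop (𝓝 0) := by
    refine squeeze_zero_norm (fun n => ?_) hhKz
    refine (hKl n _ _).trans ?_
    rw [mul_comm]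
    refine mul_le_mul_of_nonneg_right ?_ (hK0 n)
    have e : (((⌈s / h n⌉₊ : ℝ) * h n, x) : ℝ × V) - (s, x) = ((⌈s / h n⌉₊ : ℝ) * h n - s, 0) := by
      ext <;> simp
    rw [e, Prod.norm_def]
    simp only [norm_zero]
    refine max_le ?_ (hh n).le
    have h1 : (⌈s / h n⌉₊ : ℝ) < s / h n + 1 := Nat.ceil_lt_add_one (div_nonneg hsT.1.le (hh n).le)
    have h2 : s / h n ≤ (⌈s / h n⌉₊ : ℝ) := Nat.le_ceil _
    have h3 : s / h n * h n = s := div_mul_cancel₀ _ (hh n).ne'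
    rw [Real.norm_eq_abs, abs_le]
    constructor <;> nlinarith [hh n]
  have := hd.add hx
  simpa using this

theorem aux_approx {T C₀ : ℝ} (hT : 0 < T) {b : ℝ → V → V} (hb : HalfLipschitzField d T b C₀) :
    ∃ (L : ℝ≥0) (h K : ℕ → ℝ) (v Φ X : ℕ → ℕ → V → V) (Φl : ℝ → V → V),
      (∀ n, EulerData C₀ T L (h n) (K n) (v n) (Φ n) (X n)) ∧
      Tendsto h atTop (𝓝 0) ∧ Tendsto (fun n => h n * K n) atTop (𝓝 0) ∧
      (∀ᵐ s ∂(volume.restrict (Ioc 0 T)), ∀ᵐ x ∂(volume : Measure V),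
        Tendsto (fun n => v n ⌈s / h n⌉₊ x) atTop (𝓝 (b s x))) ∧
      ∀ s ∈ Icc (0:ℝ) T, ∀ x, Tendsto (fun n => Φ n ⌈s / h n⌉₊ x) atTop (𝓝 (Φl s x)) := by
  obtain ⟨L, h, K, v, Φ, X, hE, hh, hhK, hae⟩ := aux_approx0 hT hb
  have hC := hb.pos.le
  let u : ℕ → Icc (0:ℝ) T × V :=
    haveI : Nonempty (Icc (0:ℝ) T) := ⟨⟨0, left_mem_Icc.2 hT.le⟩⟩
    TopologicalSpace.denseSeq _
  have hu : DenseRange u :=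
    haveI : Nonempty (Icc (0:ℝ) T) := ⟨⟨0, left_mem_Icc.2 hT.le⟩⟩
    TopologicalSpace.denseRange_denseSeq _
  let Z : ℕ → ℕ → V := fun n i => Φ n ⌈((u i).1 : ℝ) / h n⌉₊ (u i).2
  have hZ : ∀ n, Z n ∈ Set.pi univ (fun i => Metric.closedBall (u i).2 (C₀ * T)) := by
    intro n i _
    rw [Metric.mem_closedBall, dist_eq_norm]
    refine ((hE n).phi_disp _ _).trans ?_
    gcongr
    exact aux_ceil (hE n).h_pos (hE n).grid (u i).1.2.2
  obtain ⟨z, -, φ, hφ, hz⟩ := (isCompact_univ_pi (fun i => isCompact_closedBall (u i).2 (C₀ * T))).tendsto_subseq hZ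
  rw [tendsto_pi_nhds] at hz
  have hhφ : Tendsto (fun n => h (φ n)) atTop (𝓝 0) := hh.comp hφ.tendsto_atTop
  have hest : ∀ n (s s' : Icc (0:ℝ) T) (x x' : V), ‖Φ n ⌈(s:ℝ) / h n⌉₊ x - Φ n ⌈(s':ℝ) / h n⌉₊ x'‖
      ≤ L * (C₀ * (dist s s' + h n)) + L * dist x x' := by
    intro n s s' x x'
    have e1 : ‖Φ n ⌈(s:ℝ) / h n⌉₊ x - Φ n ⌈(s':ℝ) / h n⌉₊ x‖ ≤ L * (C₀ * (dist s s' + h n)) := by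
      rcases le_total (s:ℝ) s' with hle | hle
      · rw [norm_sub_rev]
        refine (aux_time hC (hE n) s.2.1 hle s'.2.2 x).trans (le_of_eq ?_)
        rw [Subtype.dist_eq, dist_comm, Real.dist_eq, abs_of_nonneg (by linarith)]
      · refine (aux_time hC (hE n) s'.2.1 hle s.2.2 x).trans (le_of_eq ?_)
        rw [Subtype.dist_eq, Real.dist_eq, abs_of_nonneg (by linarith)]
    have e2 : ‖Φ n ⌈(s':ℝ) / h n⌉₊ x - Φ n ⌈(s':ℝ) / h n⌉₊ x'‖ ≤ L * dist x x' := by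
      rw [← dist_eq_norm]
      exact ((hE n).phi_lip _ (aux_ceil (hE n).h_pos (hE n).grid s'.2.2)).dist_le_mul _ _
    exact (norm_sub_le_norm_sub_add_norm_sub _ _ _).trans (add_le_add e1 e2)
  have hcau : ∀ (s : Icc (0:ℝ) T) (x : V), CauchySeq (fun n => Φ (φ n) ⌈(s:ℝ) / h (φ n)⌉₊ x) := by
    intro s x
    rw [Metric.cauchySeq_iff]
    intro ε hε
    obtain ⟨i, hi⟩ : ∃ i, dist (s, x) (u i) < ε / (8 * (L + 1) * (C₀ + 1)) := by
      exact hu.exists_dist_lt _ (by positivity)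
    rw [Prod.dist_eq, max_lt_iff] at hi
    have hzc := (hz i).cauchySeq
    rw [Metric.cauchySeq_iff] at hzc
    obtain ⟨N1, hN1⟩ := hzc (ε / 4) (by positivity)
    obtain ⟨N2, hN2⟩ := eventually_atTop.1 ((tendsto_order.1 hhφ).2 (ε / (8 * (L + 1) * (C₀ + 1))) (by positivity))
    refine ⟨max N1 N2, fun m hm n hn => ?_⟩
    have est : ∀ m ≥ max N1 N2, dist (Φ (φ m) ⌈(s:ℝ) / h (φ m)⌉₊ x) (Z (φ m) i) ≤ 3 * ε / 8 := by
      intro m hm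
      rw [dist_eq_norm]
      refine (hest (φ m) s (u i).1 x (u i).2).trans ?_
      have a1 := hN2 m (le_trans (le_max_right _ _) hm)
      set q := ε / (8 * (L + 1) * (C₀ + 1)) with hq
      have hqe : q * ((L + 1) * (C₀ + 1)) = ε / 8 := by rw [hq]; field_simp
      have hqp : 0 < q := by positivity
      have hL0 : (0:ℝ) ≤ L := L.2
      calc (L:ℝ) * (C₀ * (dist s (u i).1 + h (φ m))) + L * dist x (u i).2
          ≤ L * (C₀ * (q + q)) + L * q := by
            gcongr
            · exact hi.1.le
            · exact hi.2.le
        _ ≤ 3 * (q * ((L + 1) * (C₀ + 1))) := by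
            have : 0 ≤ q * L * C₀ := by positivity
            have : 0 ≤ q * L := by positivity
            have : 0 ≤ q * C₀ := by positivity
            nlinarith
        _ = _ := by rw [hqe]; ring
    have b1 := est m hm
    have b2 := est n hn
    have b3 := hN1 m (le_trans (le_max_left _ _) hm) n (le_trans (le_max_left _ _) hn)
    have b4 := dist_triangle4 (Φ (φ m) ⌈(s:ℝ) / h (φ m)⌉₊ x) (Z (φ m) i) (Z (φ n) i) (Φ (φ n) ⌈(s:ℝ) / h (φ n)⌉₊ x)
    rw [dist_comm (Z (φ n) i) (Φ (φ n) ⌈(s:ℝ) / h (φ n)⌉₊ x)] at b4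
    simp only [Function.comp_def] at b3
    linarith
  choose Φl hΦl using fun (s : Icc (0:ℝ) T) (x : V) => cauchySeq_tendsto_of_complete (hcau s x)
  classical
  refine ⟨L, h ∘ φ, K ∘ φ, v ∘ φ, Φ ∘ φ, X ∘ φ,
    fun s x => if hs : s ∈ Icc (0:ℝ) T then Φl ⟨s, hs⟩ x else 0, fun n => hE (φ n), hhφ,
    hhK.comp hφ.tendsto_atTop, ?_, ?_⟩
  · filter_upwards [hae] with s hs
    filter_upwards [hs] with x hx
    exact hx.comp hφ.tendsto_atTop
  · intro s hs x
    simp only [dif_pos hs]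
    exact hΦl ⟨s, hs⟩ x

end helpers4

section helpers5
variable {d}

theorem aux_prim_meas (g : ℝ → ℝ) (T : ℝ) :
    Measurable (fun t => if t ∈ Icc (0:ℝ) T then ∫ s in Ioc 0 t, g s else 0) := by
  let A : Set ℝ := {t | t ∈ Icc (0:ℝ) T ∧ IntegrableOn g (Ioc 0 t)}
  have hA : A.OrdConnected := by
    refine ⟨fun x hx y hy z hz => ⟨⟨hx.1.1.trans hz.1, hz.2.trans hy.1.2⟩, ?_⟩⟩
    exact hy.2.mono_set (Ioc_subset_Ioc_right hz.2)
  have hAm : MeasurableSet A := hA.measurableSet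
  have hc : ContinuousOn (fun t => ∫ s in Ioc 0 t, g s) A := by
    intro t0 ht0
    by_cases h : ∃ t1 ∈ A, t0 < t1
    · obtain ⟨t1, h1, h01⟩ := h
      have hi : IntegrableOn g (Icc 0 t1) := (integrableOn_Icc_iff_integrableOn_Ioc (by simp)).2 h1.2
      have := intervalIntegral.continuousOn_primitive hi t0 ⟨ht0.1.1, h01.le⟩
      refine this.mono_of_mem_nhdsWithin ?_
      filter_upwards [self_mem_nhdsWithin, mem_nhdsWithin_of_mem_nhds (Iio_mem_nhds h01)] with z hz hz'
      exact ⟨hz.1.1, le_of_lt hz'⟩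
    · push Not at h
      have hi : IntegrableOn g (Icc 0 t0) := (integrableOn_Icc_iff_integrableOn_Ioc (by simp)).2 ht0.2
      have := intervalIntegral.continuousOn_primitive hi t0 ⟨ht0.1.1, le_rfl⟩
      exact this.mono fun z hz => ⟨hz.1.1, h z hz⟩
  classical
  have := ContinuousOn.measurable_piecewise hc (continuousOn_const (c := (0:ℝ))) hAm
  convert this using 1
  funext t
  by_cases ht : t ∈ A
  · rw [piecewise_eq_of_mem _ _ _ ht, if_pos ht.1]
  · rw [piecewise_eq_of_notMem _ _ _ ht]
    split_ifs with h
    · exact integral_undef fun hh => ht ⟨h, hh⟩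
    · rfl

theorem aux_reg {T : ℝ} {b : ℝ → V → V} {ρ0 : V → ℝ} {ρ : ℝ → V → ℝ}
    (hs : IsCtyEqSolDet d T b ρ0 ρ) :
    ∃ (r : ℝ → V → ℝ) (M : ℝ), 0 ≤ M ∧ Measurable (Function.uncurry r) ∧
      (∀ t x, 0 ≤ r t x ∧ r t x ≤ M) ∧ ∀ t ∈ Icc (0:ℝ) T, r t =ᵐ[volume] ρ t := by
  obtain ⟨M, hM, hbd⟩ := hs.bdd
  classical
  have hmeas : ∀ φ : V → ℝ, ContDiff ℝ (⊤ : ℕ∞) φ → HasCompactSupport φ →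
      Measurable (fun t => if t ∈ Icc (0:ℝ) T then ∫ x : V, φ x * ρ t x else 0) := by
    intro φ h1 h2
    have h4 : Measurable (fun t => if t ∈ Icc (0:ℝ) T then ∫ x : V, φ x * ρ0 x else 0) :=
      Measurable.ite measurableSet_Icc measurable_const measurable_const
    have h3 := (aux_prim_meas (fun s => ∫ x : V, ⟪gradient φ x, b s x⟫ * ρ s x) T).add h4
    convert h3 using 1
    funext t
    by_cases ht : t ∈ Icc (0:ℝ) T
    · simp only [Pi.add_apply, if_pos ht]
      rw [hs.weakEq φ h1 h2 t ht, add_comm]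
    · simp only [Pi.add_apply, if_neg ht, add_zero]
  let η : ℕ → ContDiffBump (0:V) := fun n =>
    { rIn := 1 / ((n:ℝ) + 1), rOut := 2 / ((n:ℝ) + 1), rIn_pos := by positivity,
      rIn_lt_rOut := by gcongr; norm_num }
  let u : ℕ → ℝ → V → ℝ := fun n t x =>
    if t ∈ Icc (0:ℝ) T then ∫ y, (η n).normed volume (x - y) * ρ t y else 0
  have hu_conv : ∀ n t x, t ∈ Icc (0:ℝ) T → u n t x =
      convolution ((η n).normed volume) (ρ t) (ContinuousLinearMap.lsmul ℝ ℝ) volume x := by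
    intro n t x ht
    simp only [u, if_pos ht]
    rw [convolution_eq_swap]
    simp
  have hu_t : ∀ n x, Measurable (fun t => u n t x) := by
    intro n x
    refine hmeas (fun y => (η n).normed volume (x - y)) ?_ ?_
    · exact (η n).contDiff_normed.comp (contDiff_const.sub contDiff_id)
    · exact (η n).hasCompactSupport_normed.comp_homeomorph (Homeomorph.subLeft x)
  have hu_x : ∀ n t, Continuous (fun x => u n t x) := by
    intro n t
    by_cases ht : t ∈ Icc (0:ℝ) T
    · have := HasCompactSupport.continuous_convolution_left (L := ContinuousLinearMap.lsmul ℝ ℝ)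
        (μ := (volume : Measure V)) ((η n).hasCompactSupport_normed (μ := volume)) ((η n).continuous_normed (μ := volume)) (hs.int t ht).locallyIntegrable
      exact this.congr fun x => (hu_conv n t x ht).symm
    · simp only [u, if_neg ht]; exact continuous_const
  have hu_m : ∀ n, Measurable (Function.uncurry (u n)) := by
    intro n
    have := measurable_uncurry_of_continuous_of_measurable (u := fun (x : V) (t : ℝ) => u n t x)
      (fun t => hu_x n t) (fun x => hu_t n x)
    exact this.comp measurable_swap
  refine ⟨fun t x => max 0 (min M (limsup (fun n => u n t x) atTop)), M, hM.le, ?_, ?_, ?_⟩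
  · have := Measurable.limsup (f := fun n => Function.uncurry (u n)) hu_m
    exact measurable_const.max (measurable_const.min this)
  · intro t x
    exact ⟨le_max_left _ _, max_le hM.le (min_le_left _ _)⟩
  · intro t ht
    have hro : Tendsto (fun n => (η n).rOut) atTop (𝓝 0) := by
      have := (tendsto_one_div_add_atTop_nhds_zero_nat (𝕜 := ℝ)).const_mul 2
      rw [mul_zero] at this
      refine this.congr fun n => ?_
      simp only [η]; ring
    have h := ContDiffBump.ae_convolution_tendsto_right_of_locallyIntegrable (μ := (volume : Measure V))
      (φ := η) (l := atTop) (K := 2) hro (Eventually.of_forall fun n => by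
        simp only [η]; apply le_of_eq; ring) (hs.int t ht).locallyIntegrable
    filter_upwards [h, hs.nonneg t ht, hbd t ht] with x hx h0 hM'
    have : Tendsto (fun n => u n t x) atTop (𝓝 (ρ t x)) := hx.congr fun n => (hu_conv n t x ht).symm
    rw [this.limsup_eq, min_eq_right hM', max_eq_right h0]

end helpers5

section helpers6
variable {d}

theorem aux_sq_const {H : ℝ → ℝ} {t0 t1 C : ℝ} (h01 : t0 ≤ t1)
    (hH : ∀ s s', t0 ≤ s → s ≤ s' → s' ≤ t1 → |H s' - H s| ≤ C * (s' - s) ^ 2) : H t1 = H t0 := by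
  have key : ∀ N : ℕ, |H t1 - H t0| ≤ C * (t1 - t0) ^ 2 * (1 / ((N:ℝ) + 1)) := by
    intro N
    have hN : (0:ℝ) < (N:ℝ) + 1 := by positivity
    let x : ℕ → ℝ := fun i => t0 + i * ((t1 - t0) / (N + 1))
    have h0 : x 0 = t0 := by simp [x]
    have h1 : x (N + 1) = t1 := by simp only [x]; push_cast; field_simp; ring
    have hsum : H t1 - H t0 = ∑ i ∈ Finset.range (N + 1), (H (x (i + 1)) - H (x i)) := by
      rw [Finset.sum_range_sub (fun i => H (x i)), h0, h1]
    have hd : 0 ≤ (t1 - t0) / (N + 1) := div_nonneg (by linarith) hN.le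
    rw [hsum]
    refine (Finset.abs_sum_le_sum_abs _ _).trans ?_
    have : ∀ i ∈ Finset.range (N + 1), |H (x (i + 1)) - H (x i)| ≤ C * ((t1 - t0) / (N + 1)) ^ 2 := by
      intro i hi
      have hi' : ((i:ℝ) + 1) ≤ N + 1 := by
        have := Finset.mem_range.1 hi
        exact_mod_cast this
      have e : x (i + 1) - x i = (t1 - t0) / (N + 1) := by simp only [x]; push_cast; ring
      rw [← e]
      refine hH _ _ ?_ ?_ ?_
      · simp only [x]; have : 0 ≤ (i:ℝ) * ((t1 - t0) / (N + 1)) := by positivity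
        linarith
      · linarith
      · rw [← h1]; simp only [x]; push_cast; gcongr
    refine (Finset.sum_le_sum this).trans ?_
    simp only [Finset.sum_const, Finset.card_range, nsmul_eq_mul]
    push_cast
    apply le_of_eq; field_simp
  have hl : Tendsto (fun N : ℕ => C * (t1 - t0) ^ 2 * (1 / ((N:ℝ) + 1))) atTop (𝓝 0) := by
    simpa using (tendsto_one_div_add_atTop_nhds_zero_nat (𝕜 := ℝ)).const_mul (C * (t1 - t0) ^ 2)
  have := ge_of_tendsto' hl key
  have := abs_nonpos_iff.1 this
  linarith

theorem aux_diag {a p g : ℝ → ℝ → ℝ} {t0 t1 K : ℝ} (h01 : t0 ≤ t1) 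
    (h1 : ∀ s s', t0 ≤ s → s ≤ s' → s' ≤ t1 → |a s' s - a s s - (s' - s) * p s s| ≤ K * (s' - s) ^ 2)
    (h2 : ∀ s s', t0 ≤ s → s ≤ s' → s' ≤ t1 → a s' s' - a s' s = ∫ τ in Ioc s s', g s' τ)
    (h3 : ∀ s s', t0 ≤ s → s ≤ s' → s' ≤ t1 → |p s s - p s' s'| ≤ K * (s' - s))
    (h4 : ∀ s s', t0 ≤ s → s ≤ s' → s' ≤ t1 → |g s' s - g s s| ≤ K * (s' - s))
    (i1 : IntegrableOn (fun τ => p τ τ) (Ioc t0 t1))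
    (i2 : IntegrableOn (fun τ => g τ τ) (Ioc t0 t1))
    (i3 : ∀ s ∈ Icc t0 t1, IntegrableOn (fun τ => g s τ) (Ioc t0 t1)) :
    a t1 t1 - a t0 t0 = ∫ τ in Ioc t0 t1, (p τ τ + g τ τ) := by
  have key := aux_sq_const (H := fun s => a s s - ∫ τ in Ioc t0 s, (p τ τ + g τ τ)) (C := 3 * K) h01 ?_
  · simp only [Ioc_self, Measure.restrict_empty, integral_zero_measure, sub_zero] at key
    linarith
  intro s s' hs hss hs'
  have hsub : Ioc s s' ⊆ Ioc t0 t1 := Ioc_subset_Ioc hs hs'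
  have hK : 0 ≤ K * (s' - s) := (abs_nonneg _).trans (h3 s s' hs hss hs')
  have iQ : IntegrableOn (fun τ => p τ τ + g τ τ) (Ioc t0 t1) := i1.add i2
  have e1 : ∫ τ in Ioc t0 s', (p τ τ + g τ τ) =
      (∫ τ in Ioc t0 s, (p τ τ + g τ τ)) + ∫ τ in Ioc s s', (p τ τ + g τ τ) := by
    rw [← setIntegral_union (Ioc_disjoint_Ioc_of_le le_rfl) measurableSet_Ioc
      (iQ.mono_set (Ioc_subset_Ioc_right (hss.trans hs'))) (iQ.mono_set hsub), Ioc_union_Ioc_eq_Ioc hs hss]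
  have e2 : (s' - s) * p s s = ∫ τ in Ioc s s', p s s := by
    simp [hss]
  have hfin : volume (Ioc s s') < ⊤ := by simp
  have i4 : IntegrableOn (fun _ : ℝ => p s s) (Ioc s s') := integrableOn_const (by simp)
  have e3 : |∫ τ in Ioc s s', (p s s + g s' τ - (p τ τ + g τ τ))| ≤ (2 * (K * (s' - s))) * (s' - s) := by
    have := norm_setIntegral_le_of_norm_le_const (μ := (volume : Measure ℝ)) (s := Ioc s s')
      (f := fun τ => p s s + g s' τ - (p τ τ + g τ τ)) (C := 2 * (K * (s' - s))) hfin ?_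
    · simpa [hss, Measure.real] using this
    intro τ hτ
    have a1 := h3 s τ hs hτ.1.le (hτ.2.trans hs')
    have a2 := h4 τ s' (hs.trans hτ.1.le) hτ.2 hs'
    have hK2 : 0 ≤ K ∨ s' - s ≤ 0 := by
      by_contra hc; push Not at hc
      nlinarith [hc.1, hc.2]
    have hlt : 0 < s' - s := by linarith [hτ.1, hτ.2]
    have hK0 : 0 ≤ K := by rcases hK2 with h | h; exact h; linarith
    have a3 : K * (τ - s) ≤ K * (s' - s) := by gcongr; exact hτ.2
    have a4 : K * (s' - τ) ≤ K * (s' - s) := by gcongr; exact hτ.1.le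
    rw [Real.norm_eq_abs, show p s s + g s' τ - (p τ τ + g τ τ) = (p s s - p τ τ) + (g s' τ - g τ τ) by ring]
    refine (abs_add_le _ _).trans ?_
    linarith
  have i5 : IntegrableOn (fun τ => g s' τ) (Ioc s s') := (i3 s' ⟨hs.trans hss, hs'⟩).mono_set hsub
  have e4 : ∫ τ in Ioc s s', (p s s + g s' τ - (p τ τ + g τ τ)) = (s' - s) * p s s +
      (∫ τ in Ioc s s', g s' τ) - ∫ τ in Ioc s s', (p τ τ + g τ τ) := by
    have i6 : IntegrableOn (fun τ => p s s + g s' τ) (Ioc s s') := i4.add i5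
    rw [integral_sub i6 (iQ.mono_set hsub), integral_add i4 i5, e2]
  rw [e4] at e3
  have b1 := h1 s s' hs hss hs'
  have b2 := h2 s s' hs hss hs'
  rw [e1, show a s' s' - ((∫ τ in Ioc t0 s, (p τ τ + g τ τ)) + ∫ τ in Ioc s s', (p τ τ + g τ τ)) -
    (a s s - ∫ τ in Ioc t0 s, (p τ τ + g τ τ)) = (a s' s - a s s - (s' - s) * p s s) +
      ((s' - s) * p s s + (∫ τ in Ioc s s', g s' τ) - ∫ τ in Ioc s s', (p τ τ + g τ τ)) by rw [← b2]; ring]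
  refine (abs_add_le _ _).trans ?_
  nlinarith

theorem aux_ib {f r : V → ℝ} {R c M : ℝ} (hr : ∀ x, 0 ≤ r x ∧ r x ≤ M)
    (h0 : ∀ x, R < ‖x‖ → f x = 0) (hc : ∀ x, ‖x‖ ≤ R → |f x| ≤ c) :
    |∫ x, f x * r x| ≤ c * M * volume.real (Metric.closedBall (0:V) R) := by
  rw [← setIntegral_eq_integral_of_forall_compl_eq_zero (s := Metric.closedBall (0:V) R)]
  · refine norm_setIntegral_le_of_norm_le_const (f := fun x => f x * r x) (C := c * M)
      (measure_closedBall_lt_top) ?_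
    intro x hx
    rw [Real.norm_eq_abs, abs_mul, abs_of_nonneg (hr x).1]
    have := hc x (by simpa using hx)
    exact mul_le_mul this (hr x).2 (hr x).1 ((abs_nonneg _).trans this)
  · intro x hx
    rw [h0 x (by simpa using hx), zero_mul]

theorem aux_ii {f r : V → ℝ} {R c M : ℝ} (hrm : Measurable r) (hr : ∀ x, 0 ≤ r x ∧ r x ≤ M)
    (hf : Measurable f)
    (h0 : ∀ x, R < ‖x‖ → f x = 0) (hc : ∀ x, ‖x‖ ≤ R → |f x| ≤ c) :
    Integrable (fun x => f x * r x) := by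
  rw [← integrableOn_iff_integrable_of_support_subset (s := Metric.closedBall (0:V) R)]
  · refine Measure.integrableOn_of_bounded (M := c * M) (measure_closedBall_lt_top).ne
      (hf.mul hrm).aestronglyMeasurable ?_
    filter_upwards [ae_restrict_mem measurableSet_closedBall] with x hx
    rw [Real.norm_eq_abs, abs_mul, abs_of_nonneg (hr x).1]
    have := hc x (by simpa using hx)
    exact mul_le_mul this (hr x).2 (hr x).1 ((abs_nonneg _).trans this)
  · intro x hx
    by_contra h
    exact hx (by simp [h0 x (by simpa using h)])

structure NiceSol (T M : ℝ) (b : ℝ → V → V) (r : ℝ → V → ℝ) : Prop where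
  meas : Measurable (Function.uncurry r)
  bd : ∀ t x, 0 ≤ r t x ∧ r t x ≤ M
  inc : ∀ φ : V → ℝ, ContDiff ℝ (⊤ : ℕ∞) φ → HasCompactSupport φ → ∀ s t, 0 ≤ s → s ≤ t → t ≤ T →
    (∫ x, φ x * r t x) - (∫ x, φ x * r s x) = ∫ τ in Ioc s t, ∫ x, fderiv ℝ φ x (b τ x) * r τ x

theorem aux_inner_int {T C₀ : ℝ} {b : ℝ → V → V} (hb : HalfLipschitzField d T b C₀)
    {r : ℝ → V → ℝ} {M : ℝ} (hm : Measurable (Function.uncurry r))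
    (hr : ∀ t x, 0 ≤ r t x ∧ r t x ≤ M) {A : ℝ → V → (ℝ × V →L[ℝ] ℝ)} {R c : ℝ}
    (hA : Measurable (Function.uncurry A)) {S : Set ℝ} (hSm : MeasurableSet S)
    (hS : S ⊆ Icc 0 T)
    (h0 : ∀ s ∈ S, ∀ x, R < ‖x‖ → A s x = 0) (hc : ∀ s ∈ S, ∀ x, ‖x‖ ≤ R → ‖A s x‖ ≤ c) (κ : ℝ) :
    (∀ τ ∈ S, Integrable (fun x => A τ x (κ, b τ x) * r τ x)) ∧
    (∀ τ ∈ S, |∫ x, A τ x (κ, b τ x) * r τ x| ≤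
      c * (max |κ| C₀) * M * volume.real (Metric.closedBall (0:V) R)) ∧
    IntegrableOn (fun τ => ∫ x, A τ x (κ, b τ x) * r τ x) S := by
  have hmm : Measurable (Function.uncurry fun τ x => A τ x (κ, b τ x)) := by
    have h1 : Measurable fun z : ℝ × V => (κ, b z.1 z.2) := measurable_const.prodMk hb.meas
    have : Continuous fun q : (ℝ × V →L[ℝ] ℝ) × (ℝ × V) => q.1 q.2 := by fun_prop
    exact this.measurable.comp (hA.prodMk h1)
  have hbd : ∀ τ ∈ S, ∀ x, ‖x‖ ≤ R → |A τ x (κ, b τ x)| ≤ c * max |κ| C₀ := by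
    intro τ hτ x hx
    refine (ContinuousLinearMap.le_opNorm (A τ x) (κ, b τ x)).trans ?_
    refine mul_le_mul (hc τ hτ x hx) ?_ (norm_nonneg _) ((norm_nonneg _).trans (hc τ hτ x hx))
    rw [Prod.norm_def]
    exact max_le_max le_rfl (hb.bdd τ (hS hτ) x)
  have hbd0 : ∀ τ ∈ S, ∀ x, R < ‖x‖ → A τ x (κ, b τ x) = 0 := by
    intro τ hτ x hx; rw [h0 τ hτ x hx]; simp
  have hB : ∀ τ ∈ S, |∫ x, A τ x (κ, b τ x) * r τ x| ≤
      c * (max |κ| C₀) * M * volume.real (Metric.closedBall (0:V) R) := fun τ hτ =>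
    aux_ib (hr τ) (hbd0 τ hτ) (hbd τ hτ)
  refine ⟨fun τ hτ => aux_ii (hm.comp measurable_prodMk_left) (hr τ)
    (hmm.comp measurable_prodMk_left) (hbd0 τ hτ) (hbd τ hτ), hB, ?_⟩
  refine Measure.integrableOn_of_bounded (M := c * (max |κ| C₀) * M * volume.real (Metric.closedBall (0:V) R)) ?_ ?_ ?_
  · exact ((measure_mono hS).trans_lt (by simp)).ne
  · have := StronglyMeasurable.integral_prod_right (ν := (volume : Measure V))
      (f := fun τ x => A τ x (κ, b τ x) * r τ x) (hmm.mul hm).stronglyMeasurable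
    exact this.aestronglyMeasurable
  · filter_upwards [ae_restrict_mem hSm] with τ hτ
    exact hB τ hτ

end helpers6

section helpers7
variable {d}

theorem aux_cs {φ : V → ℝ} (h1 : ContDiff ℝ (⊤ : ℕ∞) φ) (h2 : HasCompactSupport φ) :
    ∃ R c : ℝ, 0 ≤ R ∧ 0 ≤ c ∧ (∀ x, R < ‖x‖ → φ x = 0 ∧ fderiv ℝ φ x = 0) ∧
      (∀ x, ‖fderiv ℝ φ x‖ ≤ c) ∧ (∀ x, |φ x| ≤ c) := by
  obtain ⟨R, hR⟩ := h2.isBounded.subset_closedBall (0:V)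
  obtain ⟨c, hc⟩ := (h1.continuous_fderiv (by simp)).bounded_above_of_compact_support (h2.fderiv ℝ)
  obtain ⟨c', hc'⟩ := h1.continuous.bounded_above_of_compact_support h2
  refine ⟨max R 0, max 0 (max c c'), le_max_right _ _, le_max_left _ _, fun x hx => ?_, fun x => ?_, fun x => ?_⟩
  · have hn : x ∉ tsupport φ := fun h => by
      have := hR h
      simp only [Metric.mem_closedBall, dist_zero_right] at this
      exact absurd ((le_max_left R 0).trans_lt hx) (not_lt.2 this)
    refine ⟨image_eq_zero_of_notMem_tsupport hn, ?_⟩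
    by_contra h
    exact hn (support_fderiv_subset ℝ h)
  · exact (hc x).trans ((le_max_left _ _).trans (le_max_right _ _))
  · exact (hc' x).trans ((le_max_right _ _).trans (le_max_right _ _))

theorem aux_nice {T C₀ : ℝ} {b : ℝ → V → V} (hb : HalfLipschitzField d T b C₀) (hT : 0 < T)
    {ρ0 : V → ℝ} {ρ : ℝ → V → ℝ} (hs : IsCtyEqSolDet d T b ρ0 ρ) :
    ∃ (r : ℝ → V → ℝ) (M : ℝ), NiceSol T M b r ∧ (∀ t ∈ Icc (0:ℝ) T, r t =ᵐ[volume] ρ t) ∧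
      ∀ φ : V → ℝ, ContDiff ℝ (⊤ : ℕ∞) φ → HasCompactSupport φ → 
        ∫ x, φ x * r 0 x = ∫ x, φ x * ρ0 x := by
  obtain ⟨r, M, hM, hrm, hr, hae⟩ := aux_reg hs
  have hint : ∀ φ : V → ℝ, ContDiff ℝ (⊤ : ℕ∞) φ → HasCompactSupport φ →
      IntegrableOn (fun τ => ∫ x, fderiv ℝ φ x (b τ x) * r τ x) (Ioc 0 T) := by
    intro φ h1 h2
    obtain ⟨R, c, hR, hc, h0, hcb, -⟩ := aux_cs h1 h2
    have := (aux_inner_int hb hrm hr (A := fun s x => (fderiv ℝ φ x).comp (ContinuousLinearMap.snd ℝ ℝ V))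
      (R := R) (c := c) ?_ (S := Ioc 0 T) measurableSet_Ioc Ioc_subset_Icc_self ?_ ?_ 0).2.2
    · simpa using this
    · have h3 : Continuous fun z : ℝ × V => (fderiv ℝ φ z.2).comp (ContinuousLinearMap.snd ℝ ℝ V) :=
        ((h1.continuous_fderiv (by simp)).comp continuous_snd).clm_comp continuous_const
      exact h3.measurable
    · intro s _ x hx; simp [(h0 x hx).2]
    · intro s _ x _
      refine (ContinuousLinearMap.opNorm_comp_le _ _).trans ?_
      calc ‖fderiv ℝ φ x‖ * ‖ContinuousLinearMap.snd ℝ ℝ V‖ ≤ c * 1 := by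
            gcongr
            · exact hcb x
            · exact ContinuousLinearMap.norm_snd_le ..
        _ = c := mul_one c
  have hw : ∀ φ : V → ℝ, ContDiff ℝ (⊤ : ℕ∞) φ → HasCompactSupport φ → ∀ t ∈ Icc (0:ℝ) T,
      ∫ x, φ x * r t x = (∫ x, φ x * ρ0 x) + ∫ τ in Ioc 0 t, ∫ x, fderiv ℝ φ x (b τ x) * r τ x := by
    intro φ h1 h2 t ht
    have e1 : ∫ x, φ x * r t x = ∫ x, φ x * ρ t x := by
      refine integral_congr_ae ?_
      filter_upwards [hae t ht] with x hx
      rw [hx]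
    rw [e1, hs.weakEq φ h1 h2 t ht]
    congr 1
    refine setIntegral_congr_fun measurableSet_Ioc fun τ hτ => ?_
    refine integral_congr_ae ?_
    filter_upwards [hae τ ⟨hτ.1.le, hτ.2.trans ht.2⟩] with x hx
    rw [hx]; simp
  refine ⟨r, M, ⟨hrm, hr, ?_⟩, hae, ?_⟩
  · intro φ h1 h2 s t hs0 hst htT
    have hi := hint φ h1 h2
    rw [hw φ h1 h2 t ⟨hs0.trans hst, htT⟩, hw φ h1 h2 s ⟨hs0, hst.trans htT⟩,
      ← Ioc_union_Ioc_eq_Ioc hs0 hst, setIntegral_union (Ioc_disjoint_Ioc_of_le le_rfl) measurableSet_Ioc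
      (hi.mono_set (Ioc_subset_Ioc_right (hst.trans htT))) (hi.mono_set (Ioc_subset_Ioc hs0 htT))]
    ring
  · intro φ h1 h2
    rw [hw φ h1 h2 0 ⟨le_rfl, hT.le⟩]; simp

theorem aux_timedep {T C₀ M : ℝ} {b : ℝ → V → V} (hb : HalfLipschitzField d T b C₀)
    {r : ℝ → V → ℝ} (hs : NiceSol T M b r) {t0 t1 R : ℝ} (h0 : 0 ≤ t0) (h01 : t0 ≤ t1) (h1 : t1 ≤ T)
    (hR : 0 ≤ R)
    {W : ℝ × V → ℝ} (hW : ContDiff ℝ (⊤ : ℕ∞) W)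
    (hsupp : ∀ s ∈ Ioo (t0 - 1) (t1 + 1), ∀ x, R < ‖x‖ → W (s, x) = 0) :
    (∫ x, W (t1, x) * r t1 x) - (∫ x, W (t0, x) * r t0 x) =
      ∫ τ in Ioc t0 t1, ∫ x, fderiv ℝ W (τ, x) (1, b τ x) * r τ x := by
  have hC := hb.pos
  have hM : 0 ≤ M := (hs.bd 0 0).1.trans (hs.bd 0 0).2
  have hD : ContDiff ℝ (⊤ : ℕ∞) (fderiv ℝ W) := hW.fderiv_right (by simp)
  have hDD : Continuous (fderiv ℝ (fderiv ℝ W)) := hD.continuous_fderiv (by simp)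
  have hWd : Differentiable ℝ W := hW.differentiable (by simp)
  have hDd : Differentiable ℝ (fderiv ℝ W) := hD.differentiable (by simp)
  let Q : Set (ℝ × V) := Icc t0 t1 ×ˢ Metric.closedBall (0:V) R
  have hQc : IsCompact Q := isCompact_Icc.prod (isCompact_closedBall _ _)
  have hQv : Convex ℝ Q := (convex_Icc _ _).prod (convex_closedBall _ _)
  obtain ⟨K1, hK1⟩ := hQc.exists_bound_of_continuousOn (f := fderiv ℝ (fderiv ℝ W)) (E := ℝ × V →L[ℝ] ℝ × V →L[ℝ] ℝ) hDD.continuousOn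
  obtain ⟨K2, hK2⟩ := hQc.exists_bound_of_continuousOn (f := fderiv ℝ W) (E := ℝ × V →L[ℝ] ℝ) hD.continuous.continuousOn
  have hK1n : 0 ≤ K1 := (norm_nonneg _).trans (hK1 (t0, 0) ⟨left_mem_Icc.2 h01, by simpa using hR⟩)
  have hsub : Icc t0 t1 ⊆ Ioo (t0 - 1) (t1 + 1) := fun s hs => ⟨by linarith [hs.1], by linarith [hs.2]⟩
  have hsubT : Icc t0 t1 ⊆ Icc 0 T := Icc_subset_Icc h0 h1
  -- derivative vanishes outside
  have hout : IsOpen ((Ioo (t0 - 1) (t1 + 1)) ×ˢ {x : V | R < ‖x‖}) :=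
    isOpen_Ioo.prod (isOpen_lt continuous_const continuous_norm)
  have hD0 : ∀ s ∈ Ioo (t0 - 1) (t1 + 1), ∀ x, R < ‖x‖ → fderiv ℝ W (s, x) = 0 := by
    intro s hs x hx
    have : W =ᶠ[𝓝 (s, x)] fun _ => 0 := by
      filter_upwards [hout.mem_nhds ⟨hs, hx⟩] with z hz
      exact hsupp z.1 hz.1 z.2 hz.2
    rw [this.fderiv_eq]; simp
  have hDlip : ∀ s ∈ Icc t0 t1, ∀ s' ∈ Icc t0 t1, ∀ x, ‖x‖ ≤ R →
      ‖fderiv ℝ W (s', x) - fderiv ℝ W (s, x)‖ ≤ K1 * |s' - s| := by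
    intro s hs s' hs' x hx
    have := hQv.norm_image_sub_le_of_norm_fderiv_le (f := fderiv ℝ W) (𝕜 := ℝ) (C := K1)
      (fun z _ => hDd z) (fun z hz => hK1 z hz) (x := (s, x)) (y := (s', x))
      ⟨hs, by simpa using hx⟩ ⟨hs', by simpa using hx⟩
    simpa [Prod.norm_def] using this
  have hlin1 : ‖((1, 0) : ℝ × V)‖ = 1 := by simp [Prod.norm_def]
  have htest : ∀ s ∈ Icc t0 t1, ContDiff ℝ (⊤ : ℕ∞) (fun x => W (s, x)) ∧ HasCompactSupport (fun x => W (s, x)) := by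
    intro s hs
    refine ⟨hW.comp (contDiff_const.prodMk contDiff_id), ?_⟩
    refine HasCompactSupport.intro (isCompact_closedBall (0:V) R) fun x hx => ?_
    exact hsupp s (hsub hs) x (by simpa using hx)
  have htestfd : ∀ s x u, fderiv ℝ (fun x => W (s, x)) x u = fderiv ℝ W (s, x) (0, u) := by
    intro s x u
    have h := (hWd (s, x)).hasFDerivAt.comp x ((hasFDerivAt_const s x).prodMk (hasFDerivAt_id x))
    have h' : HasFDerivAt (fun x => W (s, x)) _ x := h
    rw [h'.fderiv]; simp
  have hPtest : ∀ s ∈ Icc t0 t1, ContDiff ℝ (⊤ : ℕ∞) (fun x => fderiv ℝ W (s, x) (1, 0)) ∧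
      HasCompactSupport (fun x => fderiv ℝ W (s, x) (1, 0)) := by
    intro s hs
    refine ⟨(hD.comp (contDiff_const.prodMk contDiff_id)).clm_apply contDiff_const, ?_⟩
    refine HasCompactSupport.intro (isCompact_closedBall (0:V) R) fun x hx => ?_
    rw [hD0 s (hsub hs) x (by simpa using hx)]; simp
  have hPfd : ∀ s x u, fderiv ℝ (fun x => fderiv ℝ W (s, x) (1, 0)) x u =
      fderiv ℝ (fderiv ℝ W) (s, x) (0, u) (1, 0) := by
    intro s x u
    have h := (hDd (s, x)).hasFDerivAt.comp x ((hasFDerivAt_const s x).prodMk (hasFDerivAt_id x))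
    have h' : HasFDerivAt (fun x => fderiv ℝ W (s, x)) _ x := h
    have h'' := h'.clm_apply (hasFDerivAt_const ((1, 0) : ℝ × V) x)
    rw [h''.fderiv]; simp
  have hDD0 : ∀ s ∈ Ioo (t0 - 1) (t1 + 1), ∀ x, R < ‖x‖ → fderiv ℝ (fderiv ℝ W) (s, x) = 0 := by
    intro s hs x hx
    have : fderiv ℝ W =ᶠ[𝓝 (s, x)] fun _ => 0 := by
      filter_upwards [hout.mem_nhds ⟨hs, hx⟩] with z hz
      exact hD0 z.1 hz.1 z.2 hz.2
    rw [this.fderiv_eq]; simp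
  let vol := volume.real (Metric.closedBall (0:V) R)
  have hvol : 0 ≤ vol := measureReal_nonneg
  have hm : ∀ s, Measurable (r s) := fun s => hs.meas.comp measurable_prodMk_left
  -- integrability of frozen pieces
  have hAm : Measurable (Function.uncurry fun s x => fderiv ℝ W (s, x)) := by
    exact hD.continuous.measurable
  have I1 : ∀ κ : ℝ, _ := fun κ => aux_inner_int hb hs.meas hs.bd (A := fun s x => fderiv ℝ W (s, x)) (R := R) (c := K2)
    hAm (S := Icc t0 t1) measurableSet_Icc hsubT (fun s hs => hD0 s (hsub hs))
    (fun s hs x hx => hK2 (s, x) ⟨hs, by simpa using hx⟩) κ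
  have I2 : ∀ s ∈ Icc t0 t1, _ := fun s hss => aux_inner_int hb hs.meas hs.bd (A := fun _ x => fderiv ℝ W (s, x)) (R := R) (c := K2)
    (hD.continuous.comp (continuous_const.prodMk continuous_snd)).measurable (S := Icc t0 t1) measurableSet_Icc hsubT (fun _ _ => hD0 s (hsub hss))
    (fun _ _ x hx => hK2 (s, x) ⟨hss, by simpa using hx⟩) 0
  have hPi : ∀ s ∈ Icc t0 t1, ∀ τ, Integrable fun x => fderiv ℝ W (s, x) (1, 0) * r τ x := by
    intro s hss τ
    refine aux_ii (hm τ) (hs.bd τ) (R := R) (c := K2) (hPtest s hss).1.continuous.measurable ?_ ?_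
    · intro x hx; rw [hD0 s (hsub hss) x hx]; simp
    · intro x hx
      refine ((fderiv ℝ W (s, x)).le_opNorm (1, 0)).trans ?_
      rw [hlin1, mul_one]
      exact hK2 (s, x) ⟨hss, by simpa using hx⟩
  have hWi : ∀ s ∈ Icc t0 t1, ∀ τ, Integrable fun x => W (s, x) * r τ x := by
    intro s hss τ
    obtain ⟨c, hc⟩ := (htest s hss).1.continuous.bounded_above_of_compact_support (htest s hss).2
    exact aux_ii (hm τ) (hs.bd τ) (R := R) (c := c) (htest s hss).1.continuous.measurable
      (hsupp s (hsub hss)) (fun x _ => hc x)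
  let K := K1 * (1 + C₀) * M * vol
  have hK1K : K1 * M * vol ≤ K := by
    have : 0 ≤ K1 * C₀ * M * vol := by positivity
    simp only [K]; nlinarith
  have key := aux_diag (a := fun s τ => ∫ x, W (s, x) * r τ x)
    (p := fun s τ => ∫ x, fderiv ℝ W (s, x) (1, 0) * r τ x)
    (g := fun s τ => ∫ x, fderiv ℝ W (s, x) (0, b τ x) * r τ x) (K := K) h01 ?_ ?_ ?_ ?_ ?_ ?_ ?_
  · beta_reduce at key
    rw [key]
    refine setIntegral_congr_fun measurableSet_Ioc fun τ hτ => ?_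
    have hτ' : τ ∈ Icc t0 t1 := Ioc_subset_Icc_self hτ
    beta_reduce
    rw [← integral_add (hPi τ hτ' τ) ((I1 0).1 τ hτ')]
    refine integral_congr_ae (Eventually.of_forall fun x => ?_)
    beta_reduce
    rw [← add_mul, ← map_add]; simp
  · -- Taylor in time
    intro s s' hs0 hss hs1
    have ms : s ∈ Icc t0 t1 := ⟨hs0, hss.trans hs1⟩
    have ms' : s' ∈ Icc t0 t1 := ⟨hs0.trans hss, hs1⟩
    have e : (∫ x, W (s', x) * r s x) - (∫ x, W (s, x) * r s x) - (s' - s) * ∫ x, fderiv ℝ W (s, x) (1, 0) * r s x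
        = ∫ x, (W (s', x) - W (s, x) - (s' - s) * fderiv ℝ W (s, x) (1, 0)) * r s x := by
      have hWW : Integrable fun x => W (s', x) * r s x - W (s, x) * r s x := (hWi s' ms' s).sub (hWi s ms s)
      rw [← integral_const_mul, ← integral_sub (hWi s' ms' s) (hWi s ms s), ← integral_sub hWW ((hPi s ms s).const_mul _)]
      refine integral_congr_ae (Eventually.of_forall fun x => ?_)
      simp only; ring
    beta_reduce
    rw [e]
    refine (aux_ib (hs.bd s) (R := R) (c := K1 * (s' - s) ^ 2) ?_ ?_).trans ?_
    · intro x hx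
      rw [hsupp s (hsub ms) x hx, hsupp s' (hsub ms') x hx, hD0 s (hsub ms) x hx]; simp
    · intro x hx
      have hseg : ∀ z ∈ segment ℝ (s, x) (s', x), ‖fderiv ℝ W z - fderiv ℝ W (s, x)‖ ≤ K1 * (s' - s) := by
        intro z hz
        obtain ⟨θ, hθ, rfl⟩ := (segment_eq_image' ℝ (s, x) (s', x)) ▸ hz
        have hz1 : s + θ * (s' - s) ∈ Icc t0 t1 := by
          have h1 : 0 ≤ θ * (s' - s) := mul_nonneg hθ.1 (by linarith)
          have h2 : θ * (s' - s) ≤ 1 * (s' - s) := mul_le_mul_of_nonneg_right hθ.2 (by linarith)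
          exact ⟨by linarith, by linarith⟩
        have := hDlip s ms _ hz1 x hx
        have e3 : ((s, x) : ℝ × V) + θ • ((s', x) - (s, x)) = (s + θ * (s' - s), x) := by
          ext <;> simp
        simp only
        rw [e3]
        refine this.trans ?_
        gcongr
        rw [add_sub_cancel_left, abs_of_nonneg (mul_nonneg hθ.1 (by linarith))]
        nlinarith [hθ.2]
      have := (convex_segment (𝕜 := ℝ) (s, x) (s', x)).norm_image_sub_le_of_norm_hasFDerivWithin_le'
        (f := W) (f' := fderiv ℝ W) (φ := fderiv ℝ W (s, x)) (C := K1 * (s' - s))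
        (fun z _ => (hWd z).hasFDerivAt.hasFDerivWithinAt) hseg (left_mem_segment ℝ _ _) (right_mem_segment ℝ _ _)
      have e4 : ((s', x) : ℝ × V) - (s, x) = (s' - s) • ((1:ℝ), (0:V)) := by ext <;> simp
      rw [e4, map_smul, norm_smul, hlin1, Real.norm_eq_abs, Real.norm_eq_abs, smul_eq_mul, abs_of_nonneg (by linarith : 0 ≤ s' - s)] at this
      refine this.trans (le_of_eq ?_); ring
    · calc K1 * (s' - s) ^ 2 * M * vol = K1 * M * vol * (s' - s) ^ 2 := by ring
        _ ≤ _ := by gcongr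
  · intro s s' hs0 hss hs1
    have ms' : s' ∈ Icc t0 t1 := ⟨hs0.trans hss, hs1⟩
    have := hs.inc _ (htest s' ms').1 (htest s' ms').2 s s' (h0.trans hs0) hss (hs1.trans h1)
    simp only [htestfd] at this
    exact this
  · intro s s' hs0 hss hs1
    have ms : s ∈ Icc t0 t1 := ⟨hs0, hss.trans hs1⟩
    have ms' : s' ∈ Icc t0 t1 := ⟨hs0.trans hss, hs1⟩
    have hinc := hs.inc _ (hPtest s' ms').1 (hPtest s' ms').2 s s' (h0.trans hs0) hss (hs1.trans h1)
    simp only [hPfd] at hinc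
    have e1 : (∫ x, fderiv ℝ W (s, x) (1, 0) * r s x) - (∫ x, fderiv ℝ W (s', x) (1, 0) * r s x) =
        ∫ x, (fderiv ℝ W (s, x) - fderiv ℝ W (s', x)) (1, 0) * r s x := by
      rw [← integral_sub (hPi s ms s) (hPi s' ms' s)]
      refine integral_congr_ae (Eventually.of_forall fun x => ?_)
      simp only [_root_.sub_apply]; ring
    have b1 : |∫ x, (fderiv ℝ W (s, x) - fderiv ℝ W (s', x)) (1, 0) * r s x| ≤ K1 * (s' - s) * M * vol := by
      refine aux_ib (hs.bd s) ?_ ?_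
      · intro x hx
        rw [hD0 s (hsub ms) x hx, hD0 s' (hsub ms') x hx]; simp
      · intro x hx
        refine ((fderiv ℝ W (s, x) - fderiv ℝ W (s', x)).le_opNorm (1, 0)).trans ?_
        rw [hlin1, mul_one]
        have := hDlip s' ms' s ms x hx
        rwa [abs_sub_comm, abs_of_nonneg (by linarith : 0 ≤ s' - s)] at this
    have b2 : |∫ τ in Ioc s s', ∫ x, fderiv ℝ (fderiv ℝ W) (s', x) (0, b τ x) (1, 0) * r τ x| ≤
        K1 * C₀ * M * vol * (s' - s) := by
      have := norm_setIntegral_le_of_norm_le_const (μ := (volume : Measure ℝ)) (s := Ioc s s')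
        (f := fun τ => ∫ x, fderiv ℝ (fderiv ℝ W) (s', x) (0, b τ x) (1, 0) * r τ x) (C := K1 * C₀ * M * vol)
        (by simp) ?_
      · simpa [hss, Measure.real] using this
      · intro τ hτ
        refine aux_ib (hs.bd τ) ?_ ?_
        · intro x hx
          rw [hDD0 s' (hsub ms') x hx]; simp
        · intro x hx
          refine ((fderiv ℝ (fderiv ℝ W) (s', x) (0, b τ x)).le_opNorm (1, 0)).trans ?_
          rw [hlin1, mul_one]
          refine ((fderiv ℝ (fderiv ℝ W) (s', x)).le_opNorm (0, b τ x)).trans ?_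
          refine mul_le_mul (hK1 (s', x) ⟨ms', by simpa using hx⟩) ?_ (norm_nonneg _) hK1n
          simp only [Prod.norm_def, norm_zero]
          exact max_le hC.le (hb.bdd τ (hsubT ⟨hs0.trans hτ.1.le, hτ.2.trans hs1⟩) x)
    rw [← hinc] at b2
    rw [← e1] at b1
    have := abs_add_le ((∫ x, fderiv ℝ W (s, x) (1, 0) * r s x) - (∫ x, fderiv ℝ W (s', x) (1, 0) * r s x))
      (-((∫ x, fderiv ℝ W (s', x) (1, 0) * r s' x) - (∫ x, fderiv ℝ W (s', x) (1, 0) * r s x)))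
    rw [abs_neg] at this
    have e5 : (∫ x, fderiv ℝ W (s, x) (1, 0) * r s x) - (∫ x, fderiv ℝ W (s', x) (1, 0) * r s x) +
      (-((∫ x, fderiv ℝ W (s', x) (1, 0) * r s' x) - (∫ x, fderiv ℝ W (s', x) (1, 0) * r s x))) =
      (∫ x, fderiv ℝ W (s, x) (1, 0) * r s x) - (∫ x, fderiv ℝ W (s', x) (1, 0) * r s' x) := by ring
    rw [e5] at this
    refine this.trans ((add_le_add b1 b2).trans (le_of_eq ?_))
    simp only [K]; ring
  · intro s s' hs0 hss hs1
    have ms : s ∈ Icc t0 t1 := ⟨hs0, hss.trans hs1⟩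
    have ms' : s' ∈ Icc t0 t1 := ⟨hs0.trans hss, hs1⟩
    beta_reduce
    rw [← integral_sub ((I2 s' ms').1 s ms) ((I2 s ms).1 s ms)]
    have e : ∀ x, fderiv ℝ W (s', x) (0, b s x) * r s x - fderiv ℝ W (s, x) (0, b s x) * r s x =
      (fderiv ℝ W (s', x) - fderiv ℝ W (s, x)) (0, b s x) * r s x := by
      intro x; simp only [_root_.sub_apply]; ring
    simp only [e]
    refine (aux_ib (hs.bd s) (R := R) (c := K1 * (s' - s) * C₀) ?_ ?_).trans ?_
    · intro x hx
      rw [hD0 s (hsub ms) x hx, hD0 s' (hsub ms') x hx]; simp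
    · intro x hx
      refine ((fderiv ℝ W (s', x) - fderiv ℝ W (s, x)).le_opNorm (0, b s x)).trans ?_
      have := hDlip s ms s' ms' x hx
      rw [abs_of_nonneg (by linarith : 0 ≤ s' - s)] at this
      refine mul_le_mul this ?_ (norm_nonneg _) ((norm_nonneg _).trans this)
      simp only [Prod.norm_def, norm_zero]
      exact max_le hC.le (hb.bdd s (hsubT ms) x)
    · have : 0 ≤ K1 * M * vol * (s' - s) := by
        have : 0 ≤ s' - s := by linarith
        positivity
      simp only [K]; change K1 * (s' - s) * C₀ * M * vol ≤ _; nlinarith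
  · have := (aux_inner_int (C₀ := C₀) (b := fun _ _ => 0) (T := T) ⟨hC, measurable_const, fun _ _ _ => by simpa using hC.le, fun t ht x y => by simp; positivity⟩ hs.meas hs.bd (A := fun s x => fderiv ℝ W (s, x)) (R := R) (c := K2)
      hAm (S := Icc t0 t1) measurableSet_Icc hsubT (fun s hs => hD0 s (hsub hs))
      (fun s hs x hx => hK2 (s, x) ⟨hs, by simpa using hx⟩) 1).2.2
    exact this.mono_set Ioc_subset_Icc_self
  · exact (I1 0).2.2.mono_set Ioc_subset_Icc_self
  · intro s hss
    exact (I2 s hss).2.2.mono_set Ioc_subset_Icc_self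

end helpers7

section helpers8
variable {d}

/-- the error density -/
def errE (b : ℝ → V → V) (v : ℕ → V → V) (h R : ℝ) (τ : ℝ) : ℝ :=
  ∫ x in Metric.closedBall (0:V) R, ‖b τ x - v ⌈τ / h⌉₊ x‖

theorem aux_vmeas {v : ℕ → V → V} (hv : ∀ k, Continuous (v k)) (h : ℝ) :
    Measurable fun z : ℝ × V => v ⌈z.1 / h⌉₊ z.2 := by
  have h1 : Measurable fun q : ℕ × V => v q.1 q.2 :=
    measurable_from_prod_countable_right fun k => (hv k).measurable
  have h2 : Measurable fun z : ℝ × V => (⌈z.1 / h⌉₊, z.2) :=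
    (Nat.measurable_ceil.comp (measurable_fst.div_const h)).prodMk measurable_snd
  exact h1.comp h2

theorem aux_errE {T C₀ : ℝ} {b : ℝ → V → V} (hb : HalfLipschitzField d T b C₀)
    {L : ℝ≥0} {h K : ℝ} {v Φ X : ℕ → V → V} (H : EulerData C₀ T L h K v Φ X) (R : ℝ) :
    (∀ τ ∈ Icc 0 T, IntegrableOn (fun x => ‖b τ x - v ⌈τ / h⌉₊ x‖) (Metric.closedBall (0:V) R)) ∧
    (∀ τ ∈ Icc 0 T, ‖errE b v h R τ‖ ≤ 2 * C₀ * volume.real (Metric.closedBall (0:V) R)) ∧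
    AEStronglyMeasurable (errE b v h R) (volume.restrict (Ioc 0 T)) ∧
    IntegrableOn (errE b v h R) (Ioc 0 T) ∧ ∀ τ, 0 ≤ errE b v h R τ := by
  have hm : Measurable fun z : ℝ × V => ‖b z.1 z.2 - v ⌈z.1 / h⌉₊ z.2‖ :=
    (hb.meas.sub (aux_vmeas (fun k => (H.v_smooth k).continuous) h)).norm
  have hbd : ∀ τ ∈ Icc 0 T, ∀ x, ‖(‖b τ x - v ⌈τ / h⌉₊ x‖ : ℝ)‖ ≤ 2 * C₀ := by
    intro τ hτ x
    rw [norm_norm]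
    refine (norm_sub_le _ _).trans ?_
    linarith [hb.bdd τ hτ x, H.v_bdd ⌈τ / h⌉₊ x]
  have hB : ∀ τ ∈ Icc 0 T, ‖errE b v h R τ‖ ≤ 2 * C₀ * volume.real (Metric.closedBall (0:V) R) := by
    intro τ hτ
    exact norm_setIntegral_le_of_norm_le_const measure_closedBall_lt_top fun x _ => hbd τ hτ x
  have hM : AEStronglyMeasurable (errE b v h R) volume := by
    have := StronglyMeasurable.integral_prod_right (ν := (volume.restrict (Metric.closedBall (0:V) R)))
      (f := fun τ x => ‖b τ x - v ⌈τ / h⌉₊ x‖) hm.stronglyMeasurable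
    exact this.aestronglyMeasurable
  refine ⟨fun τ hτ => ?_, hB, hM.restrict, ?_, fun τ => ?_⟩
  · refine Measure.integrableOn_of_bounded (M := 2 * C₀) measure_closedBall_lt_top.ne
      (hm.comp measurable_prodMk_left).aestronglyMeasurable (Eventually.of_forall fun x => hbd τ hτ x)
  · refine Measure.integrableOn_of_bounded (by simp) hM (M := 2 * C₀ * volume.real (Metric.closedBall (0:V) R)) ?_
    filter_upwards [ae_restrict_mem measurableSet_Ioc] with τ hτ
    exact hB τ (Ioc_subset_Icc_self hτ)
  · exact integral_nonneg fun x => norm_nonneg _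

theorem aux_onestep {T C₀ M : ℝ} {b : ℝ → V → V} (hb : HalfLipschitzField d T b C₀)
    {r : ℝ → V → ℝ} (hs : NiceSol T M b r)
    {L : ℝ≥0} {h K : ℝ} {v Φ X : ℕ → V → V} (H : EulerData C₀ T L h K v Φ X)
    {f : V → ℝ} (hf : ContDiff ℝ (⊤ : ℕ∞) f) {Rf c : ℝ} (hRf : 0 ≤ Rf) (hc : 0 ≤ c)
    (hf0 : ∀ x, Rf < ‖x‖ → f x = 0) (hfc : ∀ x, ‖fderiv ℝ f x‖ ≤ c)
    (k : ℕ) (hk : ((k:ℝ) + 1) * h ≤ T) {R : ℝ} (hR : R = Rf + C₀ * (2 * T + 1)) :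
    |(∫ x, f (Φ (k + 1) x) * r (((k:ℝ) + 1) * h) x) - ∫ x, f (Φ k x) * r (k * h) x| ≤
      ∫ τ in Ioc (k * h) (((k:ℝ) + 1) * h), (c * L * M * errE b v h R τ + 
        c * L * M * (h * K) * C₀ * volume.real (Metric.closedBall (0:V) R)) := by
  have hh := H.h_pos
  have hC := hb.pos
  have hM : 0 ≤ M := (hs.bd 0 0).1.trans (hs.bd 0 0).2
  have hkh : (0:ℝ) ≤ k * h := by positivity
  have hhT : h ≤ T := by linarith
  have hkT : k * h ≤ T := by linarith
  have hT : 0 ≤ T := by linarith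
  have hR0 : 0 ≤ R := by rw [hR]; positivity
  let y : ℝ × V → V := fun z => z.2 - (z.1 - k * h) • v (k + 1) z.2
  let W : ℝ × V → ℝ := fun z => f (Φ k (y z))
  have hvs := H.v_smooth (k + 1)
  have hy : ContDiff ℝ (⊤ : ℕ∞) y :=
    contDiff_snd.sub ((contDiff_fst.sub contDiff_const).smul (hvs.comp contDiff_snd))
  have hF : ContDiff ℝ (⊤ : ℕ∞) (fun x => f (Φ k x)) := hf.comp (H.phi_smooth k)
  have hW : ContDiff ℝ (⊤ : ℕ∞) W := hF.comp hy
  have hFc : ∀ x, ‖fderiv ℝ (fun x => f (Φ k x)) x‖ ≤ c * L := by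
    intro x
    have e : fderiv ℝ (fun x => f (Φ k x)) x = (fderiv ℝ f (Φ k x)).comp (fderiv ℝ (Φ k) x) :=
      fderiv_comp x (hf.differentiable (by simp) _) ((H.phi_smooth k).differentiable (by simp) _)
    rw [e]
    refine (ContinuousLinearMap.opNorm_comp_le _ _).trans ?_
    exact mul_le_mul (hfc _) (norm_fderiv_le_of_lipschitz ℝ (H.phi_lip k hkT)) (norm_nonneg _) hc
  have hsupp : ∀ s ∈ Ioo (k * h - 1) (((k:ℝ) + 1) * h + 1), ∀ x, R < ‖x‖ → W (s, x) = 0 := by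
    intro s hs x hx
    refine hf0 _ ?_
    have a1 := H.phi_disp k (y (s, x))
    have a2 : ‖y (s, x) - x‖ ≤ (T + 1) * C₀ := by
      simp only [y]
      rw [sub_sub_cancel_left, norm_neg, norm_smul]
      refine mul_le_mul ?_ (H.v_bdd _ _) (norm_nonneg _) (by linarith)
      rw [Real.norm_eq_abs, abs_le]
      exact ⟨by linarith [hs.1], by linarith [hs.2]⟩
    have a3 : C₀ * (k * h) ≤ C₀ * T := by gcongr
    have a4 : ‖x‖ ≤ ‖Φ k (y (s, x))‖ + ‖Φ k (y (s, x)) - y (s, x)‖ + ‖y (s, x) - x‖ := by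
      have e : x = Φ k (y (s, x)) - (Φ k (y (s, x)) - y (s, x)) - (y (s, x) - x) := by abel
      conv_lhs => rw [e]
      exact (norm_sub_le _ _).trans (add_le_add_left (norm_sub_le _ _) _)
    nlinarith
  have hfd : ∀ τ x u, fderiv ℝ W (τ, x) (1, u) =
      fderiv ℝ (fun x => f (Φ k x)) (y (τ, x)) (u - v (k + 1) x - (τ - k * h) • fderiv ℝ (v (k + 1)) x u) := by
    intro τ x u
    have hv' : HasFDerivAt (fun z : ℝ × V => v (k + 1) z.2)
        ((fderiv ℝ (v (k + 1)) x).comp (ContinuousLinearMap.snd ℝ ℝ V)) (τ, x) :=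
      HasFDerivAt.comp (τ, x) (hvs.differentiable (by simp) x).hasFDerivAt hasFDerivAt_snd
    have hy' : HasFDerivAt y _ (τ, x) := hasFDerivAt_snd.sub ((hasFDerivAt_fst.sub (hasFDerivAt_const (k * h) (τ, x))).smul hv')
    have hW' : HasFDerivAt W _ (τ, x) := HasFDerivAt.comp (g := fun x => f (Φ k x)) (τ, x) (hF.differentiable (by simp) (y (τ, x))).hasFDerivAt hy'
    rw [hW'.fderiv]
    simp
    ring
  have hvK : ∀ x, ‖fderiv ℝ (v (k + 1)) x‖ ≤ K := by
    intro x
    exact norm_fderiv_le_of_lip' ℝ H.K_nn (Eventually.of_forall fun z => H.v_lip _ _ _)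
  have hlt : (k:ℝ) * h ≤ ((k:ℝ) + 1) * h := by nlinarith
  have key := aux_timedep hb hs hkh hlt hk hR0 hW hsupp
  have e1 : ∀ x, W (((k:ℝ) + 1) * h, x) = f (Φ (k + 1) x) := by
    intro x
    simp only [W, y]
    rw [H.phiS, show ((k:ℝ) + 1) * h - k * h = h by ring]
  have e0 : ∀ x, W ((k:ℝ) * h, x) = f (Φ k x) := by
    intro x; simp [W, y]
  simp only [e1, e0] at key
  rw [key]
  obtain ⟨j1, j2, j3, j4, j5⟩ := aux_errE hb H R
  have hsubT : Ioc (k * h) (((k:ℝ) + 1) * h) ⊆ Ioc 0 T := Ioc_subset_Ioc hkh hk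
  have hfin : volume (Ioc (k * h) (((k:ℝ) + 1) * h)) ≠ ⊤ := by simp
  have hIE : IntegrableOn (fun τ => c * L * M * errE b v h R τ +
      c * L * M * (h * K) * C₀ * volume.real (Metric.closedBall (0:V) R)) (Ioc (k * h) (((k:ℝ) + 1) * h)) :=
    ((j4.mono_set hsubT).const_mul _).add (integrableOn_const hfin)
  rw [← Real.norm_eq_abs]
  refine norm_integral_le_of_norm_le hIE ?_
  filter_upwards [ae_restrict_mem measurableSet_Ioc] with τ hτ
  have hτT : τ ∈ Icc 0 T := Ioc_subset_Icc_self (hsubT hτ)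
  have hceil : ⌈τ / h⌉₊ = k + 1 := by
    rw [Nat.ceil_eq_iff (by simp)]
    constructor
    · rw [lt_div_iff₀ hh]; simpa using hτ.1
    · rw [div_le_iff₀ hh]; push_cast; exact hτ.2
  have hτI : τ ∈ Ioo (k * h - 1) (((k:ℝ) + 1) * h + 1) := ⟨by linarith [hτ.1], by linarith [hτ.2]⟩
  have hout : IsOpen ((Ioo (k * h - 1) (((k:ℝ) + 1) * h + 1)) ×ˢ {x : V | R < ‖x‖}) :=
    isOpen_Ioo.prod (isOpen_lt continuous_const continuous_norm)
  rw [← setIntegral_eq_integral_of_forall_compl_eq_zero (s := Metric.closedBall (0:V) R)]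
  · have hj1 := j1 τ hτT
    have hfin2 : volume (Metric.closedBall (0:V) R) ≠ ⊤ := measure_closedBall_lt_top.ne
    have e3 : c * L * M * errE b v h R τ + c * L * M * (h * K) * C₀ * volume.real (Metric.closedBall (0:V) R)
        = ∫ x in Metric.closedBall (0:V) R, (c * L * M * ‖b τ x - v ⌈τ / h⌉₊ x‖ + c * L * M * (h * K) * C₀) := by
      rw [integral_add (hj1.const_mul _) (integrableOn_const hfin2), integral_const_mul, setIntegral_const, smul_eq_mul, errE]
      ring
    rw [e3]
    have hIE2 : IntegrableOn (fun x => c * L * M * ‖b τ x - v ⌈τ / h⌉₊ x‖ + c * L * M * (h * K) * C₀)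
      (Metric.closedBall (0:V) R) := (hj1.const_mul _).add (integrableOn_const hfin2)
    refine norm_integral_le_of_norm_le hIE2 (Eventually.of_forall fun x => ?_)
    rw [hfd, norm_mul, hceil, Real.norm_of_nonneg (hs.bd τ x).1]
    have b1 : ‖b τ x - v (k + 1) x - (τ - k * h) • fderiv ℝ (v (k + 1)) x (b τ x)‖ ≤
        ‖b τ x - v (k + 1) x‖ + h * (K * C₀) := by
      refine (norm_sub_le _ _).trans ?_
      gcongr
      rw [norm_smul]
      refine mul_le_mul ?_ ?_ (norm_nonneg _) hh.le
      · rw [Real.norm_eq_abs, abs_le]; exact ⟨by linarith [hτ.1], by linarith [hτ.2]⟩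
      · refine ((fderiv ℝ (v (k + 1)) x).le_opNorm _).trans ?_
        exact mul_le_mul (hvK x) (hb.bdd τ hτT x) (norm_nonneg _) H.K_nn
    have b2 := ((fderiv ℝ (fun x => f (Φ k x)) (y (τ, x))).le_opNorm (b τ x - v (k + 1) x - (τ - k * h) • fderiv ℝ (v (k + 1)) x (b τ x)))
    have b3 := mul_le_mul (hFc (y (τ, x))) b1 (norm_nonneg _) (by positivity)
    calc _ ≤ (c * L * (‖b τ x - v (k + 1) x‖ + h * (K * C₀))) * M := by
          refine mul_le_mul (b2.trans b3) (hs.bd τ x).2 (hs.bd τ x).1 ?_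
          have := H.K_nn
          positivity
      _ = _ := by ring
  · intro x hx
    have : W =ᶠ[𝓝 (τ, x)] fun _ => 0 := by
      filter_upwards [hout.mem_nhds ⟨hτI, by simpa using hx⟩] with z hz
      exact hsupp z.1 hz.1 z.2 hz.2
    rw [this.fderiv_eq]; simp

theorem aux_allsteps {T C₀ M : ℝ} {b : ℝ → V → V} (hb : HalfLipschitzField d T b C₀)
    {r : ℝ → V → ℝ} (hs : NiceSol T M b r)
    {L : ℝ≥0} {h K : ℝ} {v Φ X : ℕ → V → V} (H : EulerData C₀ T L h K v Φ X)
    {f : V → ℝ} (hf : ContDiff ℝ (⊤ : ℕ∞) f) {Rf c : ℝ} (hRf : 0 ≤ Rf) (hc : 0 ≤ c)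
    (hf0 : ∀ x, Rf < ‖x‖ → f x = 0) (hfc : ∀ x, ‖fderiv ℝ f x‖ ≤ c)
    (k : ℕ) (hk : (k:ℝ) * h ≤ T) {R : ℝ} (hR : R = Rf + C₀ * (2 * T + 1)) :
    |(∫ x, f (Φ k x) * r (k * h) x) - ∫ x, f x * r 0 x| ≤
      ∫ τ in Ioc 0 T, (c * L * M * errE b v h R τ + 
        c * L * M * (h * K) * C₀ * volume.real (Metric.closedBall (0:V) R)) := by
  have hh := H.h_pos
  have hC := hb.pos
  have hM : 0 ≤ M := (hs.bd 0 0).1.trans (hs.bd 0 0).2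
  obtain ⟨j1, j2, j3, j4, j5⟩ := aux_errE hb H R
  let E : ℝ → ℝ := fun τ => c * L * M * errE b v h R τ + 
        c * L * M * (h * K) * C₀ * volume.real (Metric.closedBall (0:V) R)
  have hE : IntegrableOn E (Ioc 0 T) := (j4.const_mul _).add (integrableOn_const (by simp))
  have hE0 : ∀ τ, 0 ≤ E τ := fun τ => by
    have := j5 τ
    have := H.K_nn
    simp only [E]
    positivity
  have main : ∀ k : ℕ, (k:ℝ) * h ≤ T → |(∫ x, f (Φ k x) * r (k * h) x) - ∫ x, f x * r 0 x| ≤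
      ∫ τ in Ioc 0 (k * h), E τ := by
    intro k
    induction k with
    | zero => intro _; simp [H.phi0]
    | succ k ih =>
      intro hk
      push_cast at hk ⊢
      have hlt : (k:ℝ) * h ≤ ((k:ℝ) + 1) * h := by nlinarith
      have hkh : (0:ℝ) ≤ k * h := by positivity
      have i1 := ih (hlt.trans hk)
      have i2 := aux_onestep hb hs H hf hRf hc hf0 hfc k hk hR
      rw [← Ioc_union_Ioc_eq_Ioc hkh hlt, setIntegral_union (Ioc_disjoint_Ioc_of_le le_rfl) measurableSet_Ioc
        (hE.mono_set (Ioc_subset_Ioc_right (hlt.trans hk))) (hE.mono_set (Ioc_subset_Ioc hkh hk))]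
      refine (abs_sub_le _ (∫ x, f (Φ k x) * r (k * h) x) _).trans ?_
      simp only [E] at i1 ⊢
      linarith
  refine (main k hk).trans ?_
  exact setIntegral_mono_set hE (Eventually.of_forall hE0) (Ioc_subset_Ioc_right hk).eventuallyLE

end helpers8

section helpers9
variable {d}

/-- bundle of the approximation data -/
structure Appr (T C₀ : ℝ) (b : ℝ → V → V) (L : ℝ≥0) (h K : ℕ → ℝ) (v Φ X : ℕ → ℕ → V → V)
    (Φl : ℝ → V → V) : Prop where
  E : ∀ n, EulerData C₀ T L (h n) (K n) (v n) (Φ n) (X n)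
  h0 : Tendsto h atTop (𝓝 0)
  hK0 : Tendsto (fun n => h n * K n) atTop (𝓝 0)
  conv : ∀ᵐ s ∂(volume.restrict (Ioc 0 T)), ∀ᵐ x ∂(volume : Measure V),
        Tendsto (fun n => v n ⌈s / h n⌉₊ x) atTop (𝓝 (b s x))
  lim : ∀ s ∈ Icc (0:ℝ) T, ∀ x, Tendsto (fun n => Φ n ⌈s / h n⌉₊ x) atTop (𝓝 (Φl s x))

theorem aux_err0 {T C₀ : ℝ} {b : ℝ → V → V} (hb : HalfLipschitzField d T b C₀)
    {L : ℝ≥0} {h K : ℕ → ℝ} {v Φ X : ℕ → ℕ → V → V} {Φl : ℝ → V → V}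
    (A : Appr T C₀ b L h K v Φ X Φl) (R : ℝ) {a : ℝ} (ha : 0 ≤ a) :
    Tendsto (fun n => ∫ τ in Ioc 0 T, (a * errE b (v n) (h n) R τ +
      a * (h n * K n) * C₀ * volume.real (Metric.closedBall (0:V) R))) atTop (𝓝 0) := by
  have hC := hb.pos
  have key := tendsto_integral_filter_of_dominated_convergence (μ := volume.restrict (Ioc 0 T))
    (l := atTop) (f := fun _ => (0:ℝ)) (F := fun n τ => a * errE b (v n) (h n) R τ +
      a * (h n * K n) * C₀ * volume.real (Metric.closedBall (0:V) R))
    (fun _ => a * (2 * C₀ * volume.real (Metric.closedBall (0:V) R)) +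
      a * 1 * C₀ * volume.real (Metric.closedBall (0:V) R)) ?_ ?_ ?_ ?_
  · simpa using key
  · refine Eventually.of_forall fun n => ?_
    exact ((aux_errE hb (A.E n) R).2.2.1.const_mul a).add aestronglyMeasurable_const
  · have : ∀ᶠ n in atTop, h n * K n < 1 := A.hK0.eventually (gt_mem_nhds one_pos)
    filter_upwards [this] with n hn
    filter_upwards [ae_restrict_mem measurableSet_Ioc] with τ hτ
    have e1 := (aux_errE hb (A.E n) R).2.1 τ (Ioc_subset_Icc_self hτ)
    have e2 := (aux_errE hb (A.E n) R).2.2.2.2 τ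
    have e3 : 0 ≤ h n * K n := mul_nonneg (A.E n).h_pos.le (A.E n).K_nn
    have e4 : (0:ℝ) ≤ volume.real (Metric.closedBall (0:V) R) := measureReal_nonneg
    rw [Real.norm_of_nonneg e2] at e1
    rw [Real.norm_of_nonneg (by positivity)]
    gcongr
  · exact integrable_const _
  · filter_upwards [A.conv, ae_restrict_mem measurableSet_Ioc] with τ hτ hτm
    have t1 : Tendsto (fun n => errE b (v n) (h n) R τ) atTop (𝓝 0) := by
      have := tendsto_integral_of_dominated_convergence
        (μ := (volume : Measure V).restrict (Metric.closedBall (0:V) R))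
        (F := fun n x => ‖b τ x - v n ⌈τ / h n⌉₊ x‖) (f := fun _ => (0:ℝ)) (fun _ => 2 * C₀) ?_ ?_ ?_ ?_
      · simpa only [integral_zero, errE] using this
      · intro n
        exact ((aux_errE hb (A.E n) R).1 τ (Ioc_subset_Icc_self hτm)).aestronglyMeasurable
      · exact integrableOn_const (by exact measure_closedBall_lt_top.ne)
      · intro n
        refine Eventually.of_forall fun x => ?_
        rw [norm_norm]
        refine (norm_sub_le _ _).trans ?_
        linarith [hb.bdd τ (Ioc_subset_Icc_self hτm) x, (A.E n).v_bdd ⌈τ / h n⌉₊ x]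
      · filter_upwards [ae_restrict_of_ae hτ] with x hx
        have := (tendsto_const_nhds (x := b τ x)).sub hx
        simpa using this.norm
    have t2 := (t1.const_mul a).add (((A.hK0.const_mul a).mul_const C₀).mul_const
      (volume.real (Metric.closedBall (0:V) R)))
    simpa using t2

theorem aux_ceil2 {h t : ℝ} (hh : 0 < h) (ht : 0 ≤ t) :
    t ≤ (⌈t / h⌉₊ : ℝ) * h ∧ (⌈t / h⌉₊ : ℝ) * h ≤ t + h := by
  constructor
  · have := Nat.le_ceil (t / h)
    rwa [div_le_iff₀ hh] at this
  · have := (Nat.ceil_lt_add_one (div_nonneg ht hh.le)).le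
    have h2 := mul_le_mul_of_nonneg_right this hh.le
    rw [add_mul, div_mul_cancel₀ _ hh.ne'] at h2
    linarith

theorem aux_transport {T C₀ M : ℝ} {b : ℝ → V → V} (hb : HalfLipschitzField d T b C₀)
    {L : ℝ≥0} {h K : ℕ → ℝ} {v Φ X : ℕ → ℕ → V → V} {Φl : ℝ → V → V}
    (A : Appr T C₀ b L h K v Φ X Φl) {r : ℝ → V → ℝ} (hs : NiceSol T M b r)
    {f : V → ℝ} (hf : ContDiff ℝ (⊤ : ℕ∞) f) (hfs : HasCompactSupport f) {t : ℝ} (ht : t ∈ Icc 0 T) :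
    ∫ x, f (Φl t x) * r t x = ∫ x, f x * r 0 x := by
  obtain ⟨Rf, c, hRf, hc, hf0, hfc, hfb⟩ := aux_cs hf hfs
  have hC := hb.pos
  have hM : 0 ≤ M := (hs.bd 0 0).1.trans (hs.bd 0 0).2
  set k : ℕ → ℕ := fun n => ⌈t / h n⌉₊ with hk
  have hkT : ∀ n, (k n : ℝ) * h n ≤ T := fun n => aux_ceil (A.E n).h_pos (A.E n).grid ht.2
  set R1 : ℝ := Rf + C₀ * T with hR1
  have hFs : ∀ n, ContDiff ℝ (⊤ : ℕ∞) (fun x => f (Φ n (k n) x)) := fun n => hf.comp ((A.E n).phi_smooth _)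
  have hF0 : ∀ n x, R1 < ‖x‖ → f (Φ n (k n) x) = 0 := by
    intro n x hx
    refine (hf0 _ ?_).1
    have a1 := (A.E n).phi_disp (k n) x
    have a2 : C₀ * (k n * h n) ≤ C₀ * T := by gcongr; exact hkT n
    have a3 := norm_sub_norm_le x (Φ n (k n) x)
    rw [norm_sub_rev] at a3
    linarith
  have hFcs : ∀ n, HasCompactSupport (fun x => f (Φ n (k n) x)) := by
    intro n
    refine HasCompactSupport.of_support_subset_isCompact (isCompact_closedBall (0:V) R1) ?_
    intro x hx
    by_contra hc
    exact hx (hF0 n x (by simpa using hc))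
  have hFc : ∀ n x, ‖fderiv ℝ (fun x => f (Φ n (k n) x)) x‖ ≤ c * L := by
    intro n x
    have e : fderiv ℝ (fun x => f (Φ n (k n) x)) x = (fderiv ℝ f (Φ n (k n) x)).comp (fderiv ℝ (Φ n (k n)) x) :=
      fderiv_comp x (hf.differentiable (by simp) _) (((A.E n).phi_smooth _).differentiable (by simp) _)
    rw [e]
    refine (ContinuousLinearMap.opNorm_comp_le _ _).trans ?_
    exact mul_le_mul (hfc _) (norm_fderiv_le_of_lipschitz ℝ ((A.E n).phi_lip _ (hkT n))) (norm_nonneg _) hc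
  have hFd0 : ∀ n x, R1 < ‖x‖ → fderiv ℝ (fun x => f (Φ n (k n) x)) x = 0 := by
    intro n x hx
    have : (fun x => f (Φ n (k n) x)) =ᶠ[𝓝 x] fun _ => 0 := by
      filter_upwards [(isOpen_lt continuous_const continuous_norm).mem_nhds hx] with y hy
      exact hF0 n y hy
    rw [this.fderiv_eq]; simp
  have T1 : Tendsto (fun n => ∫ x, f (Φ n (k n) x) * r (k n * h n) x) atTop (𝓝 (∫ x, f x * r 0 x)) := by
    rw [tendsto_iff_norm_sub_tendsto_zero]
    refine squeeze_zero (fun n => norm_nonneg _) (fun n => ?_)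
      (aux_err0 hb A (Rf + C₀ * (2 * T + 1)) (a := c * L * M) (by positivity))
    exact aux_allsteps hb hs (A.E n) hf hRf hc (fun x hx => (hf0 x hx).1) hfc (k n) (hkT n) rfl
  have T2 : Tendsto (fun n => (∫ x, f (Φ n (k n) x) * r (k n * h n) x) - ∫ x, f (Φ n (k n) x) * r t x) atTop (𝓝 0) := by
    rw [tendsto_zero_iff_norm_tendsto_zero]
    have hz : Tendsto (fun n => (c * L * C₀ * M * volume.real (Metric.closedBall (0:V) R1)) * h n) atTop (𝓝 0) := by
      simpa using A.h0.const_mul (c * L * C₀ * M * volume.real (Metric.closedBall (0:V) R1))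
    refine squeeze_zero (fun n => norm_nonneg _) (fun n => ?_) hz
    obtain ⟨c1, c2⟩ := aux_ceil2 (A.E n).h_pos ht.1
    rw [hs.inc _ (hFs n) (hFcs n) t (k n * h n) ht.1 c1 (hkT n)]
    have := norm_setIntegral_le_of_norm_le_const (μ := volume) (s := Ioc t (k n * h n))
      (f := fun τ => ∫ x, fderiv ℝ (fun x => f (Φ n (k n) x)) x (b τ x) * r τ x)
      (C := c * L * C₀ * M * volume.real (Metric.closedBall (0:V) R1)) (by simp) ?_
    · refine this.trans ?_
      have e4 : (0:ℝ) ≤ volume.real (Metric.closedBall (0:V) R1) := measureReal_nonneg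
      gcongr
      rw [Real.volume_real_Ioc_of_le c1]
      linarith
    · intro τ hτ
      rw [Real.norm_eq_abs]
      refine aux_ib (hs.bd τ) (fun x hx => by rw [hFd0 n x hx]; simp) fun x hx => ?_
      rw [← Real.norm_eq_abs]
      refine (ContinuousLinearMap.le_opNorm _ _).trans ?_
      exact mul_le_mul (hFc n x) (hb.bdd τ ⟨ht.1.trans hτ.1.le, hτ.2.trans (hkT n)⟩ x) (norm_nonneg _) (by positivity)
  have T3 : Tendsto (fun n => ∫ x, f (Φ n (k n) x) * r t x) atTop (𝓝 (∫ x, f (Φl t x) * r t x)) := by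
    have hrm : Measurable (r t) := hs.meas.comp measurable_prodMk_left
    refine tendsto_integral_of_dominated_convergence (fun x => (Metric.closedBall (0:V) R1).indicator (fun _ => c * M) x) ?_ ?_ ?_ ?_
    · intro n
      exact ((hFs n).continuous.measurable.mul hrm).aestronglyMeasurable
    · rw [integrable_indicator_iff Metric.isClosed_closedBall.measurableSet]
      exact integrableOn_const (by exact measure_closedBall_lt_top.ne)
    · intro n
      refine Eventually.of_forall fun x => ?_
      by_cases hx : x ∈ Metric.closedBall (0:V) R1
      · rw [indicator_of_mem hx, norm_mul, Real.norm_eq_abs, Real.norm_of_nonneg (hs.bd t x).1]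
        exact mul_le_mul (hfb _) (hs.bd t x).2 (hs.bd t x).1 hc
      · rw [indicator_of_notMem hx, hF0 n x (by simpa using hx)]; simp
    · refine Eventually.of_forall fun x => ?_
      exact ((hf.continuous.tendsto _).comp (A.lim t ht x)).mul_const _
  have T4 := T1.sub T2
  simp only [sub_sub_cancel, sub_zero] at T4
  exact tendsto_nhds_unique T3 T4
end helpers9

section helpers10
variable {d}

theorem aux_meas_ext {μ ν : Measure V} [IsFiniteMeasure μ] [IsFiniteMeasure ν]
    (H : ∀ f : V → ℝ, ContDiff ℝ (⊤ : ℕ∞) f → HasCompactSupport f → ∫ x, f x ∂μ = ∫ x, f x ∂ν) :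
    μ = ν := by
  refine Measure.ext_of_integral_eq_on_compactlySupported fun g => ?_
  have hg : Continuous g := g.continuous
  have hgs : HasCompactSupport g := g.hasCompactSupport
  obtain ⟨C, hC⟩ := hg.bounded_above_of_compact_support hgs
  have hC0 : 0 ≤ C := (norm_nonneg _).trans (hC 0)
  let φ : ℕ → ContDiffBump (0 : V) := fun n => ⟨1 / ((n:ℝ) + 2), 1 / ((n:ℝ) + 1), by positivity, by
    apply one_div_lt_one_div_of_lt (by positivity); linarith⟩
  have hφ : Tendsto (fun n => (φ n).rOut) atTop (𝓝 0) := tendsto_one_div_add_atTop_nhds_zero_nat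
  let F : ℕ → V → ℝ := fun n => convolution ((φ n).normed volume) g (ContinuousLinearMap.lsmul ℝ ℝ) volume
  have hFs : ∀ n, ContDiff ℝ (⊤ : ℕ∞) (F n) := fun n =>
    (φ n).hasCompactSupport_normed.contDiff_convolution_left _ (φ n).contDiff_normed hg.locallyIntegrable
  have hFc : ∀ n, HasCompactSupport (F n) := fun n =>
    (φ n).hasCompactSupport_normed.convolution _ hgs
  have hFb : ∀ n x, ‖F n x‖ ≤ C := by
    intro n x
    rw [← dist_zero_right]
    refine dist_convolution_le hC0 (φ n).support_normed_eq.subset (φ n).nonneg_normed (φ n).integral_normed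
      hg.aestronglyMeasurable fun y _ => ?_
    rw [dist_zero_right]; exact hC y
  have hlim : ∀ (κ : Measure V) [IsFiniteMeasure κ],
      Tendsto (fun n => ∫ x, F n x ∂κ) atTop (𝓝 (∫ x, g x ∂κ)) := by
    intro κ _
    refine tendsto_integral_of_dominated_convergence (fun _ => C) ?_ (integrable_const _) ?_ ?_
    · exact fun n => (hFs n).continuous.aestronglyMeasurable
    · exact fun n => Eventually.of_forall (hFb n)
    · exact Eventually.of_forall fun x => ContDiffBump.convolution_tendsto_right_of_continuous hφ hg x
  refine tendsto_nhds_unique (hlim μ) ?_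
  refine (hlim ν).congr fun n => ?_
  exact (H _ (hFs n) (hFc n)).symm

theorem aux_wd_int {r f : V → ℝ} (hr : Measurable r) (h0 : ∀ᵐ x, 0 ≤ r x) :
    ∫ x, f x ∂(volume.withDensity fun x => ENNReal.ofReal (r x)) = ∫ x, f x * r x := by
  rw [integral_withDensity_eq_integral_toReal_smul hr.ennreal_ofReal (by simp)]
  refine integral_congr_ae ?_
  filter_upwards [h0] with x hx
  rw [ENNReal.toReal_ofReal hx, smul_eq_mul, mul_comm]

theorem aux_phil_lip {T C₀ : ℝ} {b : ℝ → V → V}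
    {L : ℝ≥0} {h K : ℕ → ℝ} {v Φ X : ℕ → ℕ → V → V} {Φl : ℝ → V → V}
    (A : Appr T C₀ b L h K v Φ X Φl) {t : ℝ} (ht : t ∈ Icc 0 T) :
    (∀ n, LipschitzWith L (Φ n ⌈t / h n⌉₊)) ∧ LipschitzWith L (Φl t) := by
  have h1 : ∀ n, LipschitzWith L (Φ n ⌈t / h n⌉₊) := fun n =>
    (A.E n).phi_lip _ (aux_ceil (A.E n).h_pos (A.E n).grid ht.2)
  exact ⟨h1, aux_unif_lip h1 (A.lim t ht)⟩

theorem aux_good_lim {T C₀ : ℝ} {b : ℝ → V → V}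
    {L : ℝ≥0} {h K : ℕ → ℝ} {v Φ X : ℕ → ℕ → V → V} {Φl : ℝ → V → V}
    (A : Appr T C₀ b L h K v Φ X Φl) {t : ℝ} (ht : t ∈ Icc 0 T) {a : V} (ha : a ∈ Good (Φl t)) :
    Tendsto (fun n => X n ⌈t / h n⌉₊ (Φl t a)) atTop (𝓝 a) :=
  aux_inv_conv (aux_phil_lip A ht).1 (A.lim t ht) (fun n => (A.E n).X_cont _)
    (fun n => (A.E n).XPhi _) (fun n => (A.E n).PhiX _) ha

theorem aux_pushforward {T C₀ : ℝ} (hT : 0 < T) {b : ℝ → V → V} (hb : HalfLipschitzField d T b C₀)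
    {L : ℝ≥0} {h K : ℕ → ℝ} {v Φ X : ℕ → ℕ → V → V} {Φl : ℝ → V → V}
    (A : Appr T C₀ b L h K v Φ X Φl) {ρ0 : V → ℝ} (hρ0 : IsProbDensity d ρ0)
    {ρ : ℝ → V → ℝ} (hs : IsCtyEqSolDet d T b ρ0 ρ) {t : ℝ} (ht : t ∈ Icc 0 T) :
    (volume.withDensity fun x => ENNReal.ofReal (ρ t x)).map (Φl t) =
      volume.withDensity fun x => ENNReal.ofReal (ρ0 x) := by
  have hi0 : Integrable ρ0 := by
    by_contra hc
    have := hρ0.2.2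
    rw [integral_undef hc] at this
    simp at this
  haveI := isFiniteMeasure_withDensity_ofReal hi0.2
  haveI := isFiniteMeasure_withDensity_ofReal (hs.int t ht).2
  have hΦ : Continuous (Φl t) := (aux_phil_lip A ht).2.continuous
  obtain ⟨r, M, hr, hrt, hr0⟩ := aux_nice hb hT hs
  refine aux_meas_ext fun f hf hfs => ?_
  rw [integral_map hΦ.aemeasurable hf.continuous.aestronglyMeasurable,
    aux_wd_int (hs.meas t) (hs.nonneg t ht), aux_wd_int hρ0.1 (Eventually.of_forall hρ0.2.1),
    ← hr0 f hf hfs, ← aux_transport hb A hr hf hfs ht]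
  refine integral_congr_ae ?_
  filter_upwards [hrt t ht] with x hx
  rw [hx]

theorem aux_uniqueness {T C₀ : ℝ} (hT : 0 < T) {b : ℝ → V → V} (hb : HalfLipschitzField d T b C₀)
    {L : ℝ≥0} {h K : ℕ → ℝ} {v Φ X : ℕ → ℕ → V → V} {Φl : ℝ → V → V}
    (A : Appr T C₀ b L h K v Φ X Φl) {ρ0 : V → ℝ} (hρ0 : IsProbDensity d ρ0)
    {ρ ρ' : ℝ → V → ℝ} (hs : IsCtyEqSolDet d T b ρ0 ρ) (hs' : IsCtyEqSolDet d T b ρ0 ρ')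
    {t : ℝ} (ht : t ∈ Icc 0 T) : ρ t =ᵐ[volume] ρ' t := by
  have hinj : InjOn (Φl t) (Good (Φl t)) := by
    intro a ha a' ha' e
    have h1 := aux_good_lim A ht ha
    rw [e] at h1
    exact tendsto_nhds_unique h1 (aux_good_lim A ht ha')
  have := aux_unique (aux_phil_lip A ht).2 hinj (withDensity_absolutelyContinuous _ _)
    (aux_pushforward hT hb A hρ0 hs ht) (aux_pushforward hT hb A hρ0 hs' ht)
  rw [withDensity_eq_iff_of_sigmaFinite (hs.meas t).ennreal_ofReal.aemeasurable
    (hs'.meas t).ennreal_ofReal.aemeasurable] at this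
  filter_upwards [this, hs.nonneg t ht, hs'.nonneg t ht] with x hx h1 h2
  exact (ENNReal.ofReal_eq_ofReal_iff h1 h2).1 hx
end helpers10

section helpers11
variable {d}

theorem aux_law {L : ℝ≥0} {Φ Y : V → V} (hL : LipschitzWith L Φ) (hY : Measurable Y)
    (hae : ∀ᵐ y, Φ (Y y) = y) {ν : Measure V} {c : ℝ≥0} (hν : ν ≤ c • volume) :
    ν.map Y ≤ (c * L ^ d) • volume := by
  refine Measure.le_iff.2 fun s hs => ?_
  rw [Measure.map_apply hY hs]
  refine (hν _).trans ?_
  rw [Measure.smul_apply, Measure.smul_apply, ENNReal.smul_def, ENNReal.smul_def, smul_eq_mul, smul_eq_mul,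
    ENNReal.coe_mul, mul_assoc]
  gcongr
  have : volume (Y ⁻¹' s) ≤ volume (Φ '' s) := by
    refine measure_mono_ae ?_
    filter_upwards [hae] with y hy hys
    exact ⟨Y y, hys, hy⟩
  refine this.trans ((aux_lip_vol hL s).trans ?_)
  rw [ENNReal.coe_pow]

theorem aux_flow {T C₀ : ℝ} {b : ℝ → V → V} (hb : HalfLipschitzField d T b C₀)
    {L : ℝ≥0} {h K : ℕ → ℝ} {v Φ X : ℕ → ℕ → V → V} {Φl : ℝ → V → V}
    (A : Appr T C₀ b L h K v Φ X Φl) :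
    ∃ Xl : ℝ → V → V, (∀ s, Measurable (Xl s)) ∧ ∀ s ∈ Icc 0 T,
      (∀ᵐ y, Tendsto (fun n => X n ⌈s / h n⌉₊ y) atTop (𝓝 (Xl s y))) ∧
      ∀ᵐ y, Φl s (Xl s y) = y := by
  have key : ∀ s, ∃ Xs : V → V, Measurable Xs ∧ (s ∈ Icc 0 T →
      (∀ᵐ y, Tendsto (fun n => X n ⌈s / h n⌉₊ y) atTop (𝓝 (Xs y))) ∧
      ∀ᵐ y, Φl s (Xs y) = y) := by
    intro s
    by_cases hs : s ∈ Icc 0 T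
    swap
    · exact ⟨id, measurable_id, fun h => absurd h hs⟩
    have hL := (aux_phil_lip A hs)
    have hsurj : ∀ y, ∃ a, Φl s a = y := by
      refine aux_surj hL.1 (A.lim s hs) (fun n => (A.E n).PhiX _) (D := C₀ * T) fun n y => ?_
      have := (A.E n).phi_disp ⌈s / h n⌉₊ (X n ⌈s / h n⌉₊ y)
      rw [(A.E n).PhiX, ← dist_eq_norm, dist_comm] at this
      refine this.trans ?_
      have := hb.pos
      gcongr
      exact aux_ceil (A.E n).h_pos (A.E n).grid hs.2
    have hgood : ∀ᵐ y, ∃ a ∈ Good (Φl s), Φl s a = y := by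
      refine measure_mono_null ?_ (aux_degenerate hL.2)
      intro y hy
      obtain ⟨a, ha⟩ := hsurj y
      refine ⟨a, fun hg => hy ⟨a, hg, ha⟩, ha⟩
    obtain ⟨Xs, hm, hlim⟩ := measurable_limit_of_tendsto_metrizable_ae (μ := (volume : Measure V)) (L := atTop)
      (f := fun n y => X n ⌈s / h n⌉₊ y) (fun n => ((A.E n).X_cont _).measurable.aemeasurable) (by
        filter_upwards [hgood] with y hy
        obtain ⟨a, ha, rfl⟩ := hy
        exact ⟨a, aux_good_lim A hs ha⟩)
    refine ⟨Xs, hm, fun _ => ⟨hlim, ?_⟩⟩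
    filter_upwards [hlim, hgood] with y hy hg
    obtain ⟨a, ha, rfl⟩ := hg
    rw [tendsto_nhds_unique hy (aux_good_lim A hs ha)]
  choose Xl h1 h2 using key
  exact ⟨Xl, h1, h2⟩

theorem aux_comp_int {ν : Measure V} {Y : V → V} (hY : Measurable Y) {a : ℝ≥0}
    (hν : ν.map Y ≤ a • volume) {u : V → ℝ} (hu : Measurable u) (hi : Integrable u) :
    Integrable (fun y => u (Y y)) ν ∧ |∫ y, u (Y y) ∂ν| ≤ a * ∫ x, |u x| := by
  have h1 : Integrable u (a • volume) := hi.smul_measure_nnreal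
  have h2 : Integrable u (ν.map Y) := h1.mono_measure hν
  refine ⟨h2.comp_measurable hY, ?_⟩
  rw [← integral_map hY.aemeasurable hu.aestronglyMeasurable]
  refine abs_integral_le_integral_abs.trans ?_
  refine (integral_mono_measure hν (Eventually.of_forall fun x => abs_nonneg _) h1.abs).trans ?_
  rw [integral_smul_nnreal_measure]
  rfl

theorem aux_conv {ν : Measure V} [IsFiniteMeasure ν] {Y : ℕ → V → V} {Z : V → V} (hY : ∀ n, Measurable (Y n))
    (hZ : Measurable Z) {a : ℝ≥0} (hYν : ∀ n, ν.map (Y n) ≤ a • volume) (hZν : ν.map Z ≤ a • volume)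
    (hYZ : ∀ᵐ y ∂ν, Tendsto (fun n => Y n y) atTop (𝓝 (Z y)))
    {g : ℕ → V → ℝ} {g' : V → ℝ} (hg : ∀ n, Measurable (g n)) (hg' : Measurable g') {R c : ℝ}
    (hgb : ∀ n x, |g n x| ≤ c) (hgb' : ∀ x, |g' x| ≤ c)
    (hg0 : ∀ n x, R < ‖x‖ → g n x = 0) (hg0' : ∀ x, R < ‖x‖ → g' x = 0)
    (hgg : ∀ᵐ x, Tendsto (fun n => g n x) atTop (𝓝 (g' x))) :
    Tendsto (fun n => ∫ y, g n (Y n y) ∂ν) atTop (𝓝 (∫ y, g' (Z y) ∂ν)) := by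
  have hbi : Integrable (fun x => (Metric.closedBall (0:V) R).indicator (fun _ => c) x) := by
    rw [integrable_indicator_iff Metric.isClosed_closedBall.measurableSet]
    exact integrableOn_const (by exact measure_closedBall_lt_top.ne)
  have dom : ∀ {u : V → ℝ}, (∀ x, |u x| ≤ c) → (∀ x, R < ‖x‖ → u x = 0) →
      ∀ x, ‖u x‖ ≤ (Metric.closedBall (0:V) R).indicator (fun _ => c) x := by
    intro u h1 h2 x
    by_cases hx : x ∈ Metric.closedBall (0:V) R
    · rw [indicator_of_mem hx]; exact h1 x
    · rw [indicator_of_notMem hx, h2 x (by simpa using hx)]; simp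
  have hgi : ∀ n, Integrable (g n) := fun n =>
    hbi.mono' (hg n).aestronglyMeasurable (Eventually.of_forall (dom (hgb n) (hg0 n)))
  have hgi' : Integrable g' := hbi.mono' hg'.aestronglyMeasurable (Eventually.of_forall (dom hgb' hg0'))
  have L1 : Tendsto (fun n => ∫ x, |g n x - g' x|) atTop (𝓝 0) := by
    have := tendsto_integral_of_dominated_convergence (μ := (volume : Measure V))
      (F := fun n x => |g n x - g' x|) (f := fun _ => (0:ℝ))
      (fun x => (Metric.closedBall (0:V) R).indicator (fun _ => c) x + (Metric.closedBall (0:V) R).indicator (fun _ => c) x) ?_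
      (hbi.add hbi) ?_ ?_
    · simpa using this
    · exact fun n => ((hgi n).sub hgi').abs.aestronglyMeasurable
    · refine fun n => Eventually.of_forall fun x => ?_
      rw [Real.norm_eq_abs, abs_abs]
      refine (abs_sub _ _).trans ?_
      exact add_le_add (dom (hgb n) (hg0 n) x) (dom hgb' hg0' x)
    · filter_upwards [hgg] with x hx
      have := (hx.sub_const (g' x)).abs
      simpa using this
  rw [Metric.tendsto_atTop']
  intro ε hε
  set δ : ℝ := ε / (4 * ((a:ℝ) + 1)) with hδ
  have ha : (0:ℝ) ≤ a := a.2
  have hδ0 : 0 < δ := by positivity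
  have haδ : a * δ ≤ ε / 4 := by
    have : ((a:ℝ) + 1) * δ = ε / 4 := by rw [hδ]; field_simp
    nlinarith
  obtain ⟨w, hws, hwd, hwc, hwi⟩ := hgi'.exists_hasCompactSupport_integral_sub_le hδ0
  obtain ⟨C, hC⟩ := hwc.bounded_above_of_compact_support hws
  have L2 : Tendsto (fun n => ∫ y, w (Y n y) ∂ν) atTop (𝓝 (∫ y, w (Z y) ∂ν)) := by
    refine tendsto_integral_of_dominated_convergence (fun _ => C) ?_ (integrable_const _) ?_ ?_
    · exact fun n => (hwc.measurable.comp (hY n)).aestronglyMeasurable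
    · exact fun n => Eventually.of_forall fun y => hC _
    · filter_upwards [hYZ] with y hy
      exact (hwc.tendsto _).comp hy
  have E1 : ∀ᶠ n in atTop, a * ∫ x, |g n x - g' x| < ε / 4 := by
    have := L1.const_mul (a:ℝ)
    rw [mul_zero] at this
    exact this.eventually (gt_mem_nhds (by positivity))
  have E2 : ∀ᶠ n in atTop, |(∫ y, w (Y n y) ∂ν) - ∫ y, w (Z y) ∂ν| < ε / 4 := by
    have := (L2.sub_const (∫ y, w (Z y) ∂ν)).abs
    rw [sub_self, abs_zero] at this
    exact this.eventually (gt_mem_nhds (by positivity))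
  obtain ⟨N, hN⟩ := eventually_atTop.1 (E1.and E2)
  refine ⟨N, fun n hn => ?_⟩
  obtain ⟨e1, e2⟩ := hN n hn.le
  rw [Real.dist_eq]
  have i1 := aux_comp_int (hY n) (hYν n) ((hg n).sub hg') ((hgi n).sub hgi')
  have i2 := aux_comp_int (hY n) (hYν n) (hg'.sub hwc.measurable) (hgi'.sub hwi)
  have i3 := aux_comp_int hZ hZν (hg'.sub hwc.measurable) (hgi'.sub hwi)
  have j1 := (aux_comp_int (hY n) (hYν n) (hg n) (hgi n)).1
  have j2 := (aux_comp_int (hY n) (hYν n) hg' hgi').1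
  have j3 := (aux_comp_int (hY n) (hYν n) hwc.measurable hwi).1
  have j4 := (aux_comp_int hZ hZν hg' hgi').1
  have j5 := (aux_comp_int hZ hZν hwc.measurable hwi).1
  have q1 := i1.2
  have q2 := i2.2
  have q3 := i3.2
  simp only [Pi.sub_apply] at q1 q2 q3
  rw [integral_sub j1 j2] at q1
  rw [integral_sub j2 j3] at q2
  rw [integral_sub j4 j5] at q3
  have hwd' : a * ∫ x, |g' x - w x| ≤ ε / 4 := by
    refine le_trans ?_ haδ
    gcongr
    exact hwd
  have r1 := q1.trans_lt e1
  have r2 := q2.trans hwd'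
  have r3 := q3.trans hwd'
  rw [abs_lt] at r1 e2 ⊢
  rw [abs_le] at r2 r3
  constructor <;> linarith [r1.1, r1.2, r2.1, r2.2, r3.1, r3.2, e2.1, e2.2]

theorem aux_dens {μ : Measure V} [IsFiniteMeasure μ] {a : ℝ≥0} (h : μ ≤ a • volume) :
    (∀ᵐ x, (μ.rnDeriv volume x).toReal ≤ a) ∧
    ∀ f : V → ℝ, ∫ x, f x * (μ.rnDeriv volume x).toReal = ∫ x, f x ∂μ := by
  have hac : μ ≪ volume := (Measure.absolutelyContinuous_of_le h).trans
    (Measure.smul_absolutelyContinuous)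
  constructor
  · have : ∀ᵐ x, μ.rnDeriv volume x ≤ (a : ℝ≥0∞) := by
      refine ae_le_of_forall_setLIntegral_le_of_sigmaFinite (Measure.measurable_rnDeriv _ _) fun s hs _ => ?_
      rw [Measure.setLIntegral_rnDeriv hac, setLIntegral_const]
      exact h s
    filter_upwards [this] with x hx
    exact ENNReal.toReal_le_coe_of_le_coe hx
  · intro f
    rw [← integral_rnDeriv_smul hac]
    refine integral_congr_ae (Eventually.of_forall fun x => ?_)
    simp [mul_comm]
end helpers11

section helpers12
variable {d}

theorem aux_taylor {φ : V → ℝ} (hφ : ContDiff ℝ (⊤ : ℕ∞) φ) {c2 : ℝ} (hc2 : 0 ≤ c2)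
    (h2 : ∀ x y, ‖fderiv ℝ φ x - fderiv ℝ φ y‖ ≤ c2 * ‖x - y‖) (x z : V) :
    |φ x - φ (x - z) - fderiv ℝ φ x z| ≤ c2 * ‖z‖ ^ 2 := by
  have := Convex.norm_image_sub_le_of_norm_fderiv_le' (𝕜 := ℝ) (f := φ) (φ := fderiv ℝ φ x) (C := c2 * ‖z‖)
    (s := Metric.closedBall x ‖z‖) (x := x) (y := x - z)
    (fun y _ => hφ.differentiable (by simp) y) (fun y hy => by
      refine (h2 y x).trans ?_
      rw [Metric.mem_closedBall, dist_eq_norm] at hy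
      gcongr) (convex_closedBall _ _) (by simp) (by simp [dist_eq_norm])
  rw [Real.norm_eq_abs] at this
  have e : x - z - x = -z := by abel
  rw [e, map_neg, norm_neg] at this
  rw [abs_sub_comm] at this
  calc |φ x - φ (x - z) - fderiv ℝ φ x z| = |(-(fderiv ℝ φ x z)) - (φ (x - z) - φ x)| := by
        congr 1; ring
    _ ≤ c2 * ‖z‖ * ‖z‖ := this
    _ = _ := by ring

theorem aux_disc {T C₀ : ℝ} (hC : 0 ≤ C₀) {L : ℝ≥0} {h K : ℝ} {v Φ X : ℕ → V → V} (H : EulerData C₀ T L h K v Φ X)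
    {φ : V → ℝ} (hφ : ContDiff ℝ (⊤ : ℕ∞) φ) {c c2 : ℝ} (hc : 0 ≤ c) (hc2 : 0 ≤ c2)
    (h1 : ∀ x, ‖fderiv ℝ φ x‖ ≤ c)
    (h2 : ∀ x y, ‖fderiv ℝ φ x - fderiv ℝ φ y‖ ≤ c2 * ‖x - y‖) (y : V) {t : ℝ} (ht : t ∈ Icc 0 T) :
    |φ (X ⌈t / h⌉₊ y) - φ y - ∫ s in Ioc 0 t, fderiv ℝ φ (X ⌈s / h⌉₊ y) (v ⌈s / h⌉₊ (X ⌈s / h⌉₊ y))|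
      ≤ (c2 * C₀ ^ 2 * T + c * C₀) * h := by
  have hh := H.h_pos
  set g : ℕ → ℝ := fun k => fderiv ℝ φ (X k y) (v k (X k y)) with hg
  have hgb : ∀ k, ‖g k‖ ≤ c * C₀ := by
    intro k
    refine (ContinuousLinearMap.le_opNorm _ _).trans ?_
    exact mul_le_mul (h1 _) (H.v_bdd _ _) (norm_nonneg _) hc
  have hgm : Measurable fun s : ℝ => g ⌈s / h⌉₊ :=
    (measurable_of_countable g).comp (Nat.measurable_ceil.comp (measurable_id.div_const h))
  have hgi : ∀ p q : ℝ, IntegrableOn (fun s : ℝ => g ⌈s / h⌉₊) (Ioc p q) := by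
    intro p q
    exact Measure.integrableOn_of_bounded (M := c * C₀) (by simp) hgm.aestronglyMeasurable
      (Eventually.of_forall fun s => hgb _)
  have hsplit : ∀ p q : ℝ, 0 ≤ p → p ≤ q → ∫ s in Ioc 0 q, g ⌈s / h⌉₊ =
      (∫ s in Ioc 0 p, g ⌈s / h⌉₊) + ∫ s in Ioc p q, g ⌈s / h⌉₊ := by
    intro p q hp hpq
    rw [← setIntegral_union (Ioc_disjoint_Ioc_of_le le_rfl) measurableSet_Ioc (hgi _ _) (hgi _ _),
      Ioc_union_Ioc_eq_Ioc hp hpq]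
  have key : ∀ k : ℕ, |φ (X k y) - φ y - ∫ s in Ioc 0 ((k:ℝ) * h), g ⌈s / h⌉₊| ≤ k * (c2 * (h * C₀) ^ 2) := by
    intro k
    induction k with
    | zero =>
      have : X 0 y = y := by
        have := H.PhiX 0 y
        rwa [H.phi0] at this
      simp [this]
    | succ k ih =>
      have hk0 : (0:ℝ) ≤ k * h := by positivity
      have e1 : ∫ s in Ioc (k * h) (((k + 1 : ℕ):ℝ) * h), g ⌈s / h⌉₊ = h * g (k + 1) := by
        have : ∫ s in Ioc (k * h) (((k + 1 : ℕ):ℝ) * h), g ⌈s / h⌉₊ =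
            ∫ s in Ioc (k * h) (((k + 1 : ℕ):ℝ) * h), g (k + 1) := by
          refine setIntegral_congr_fun measurableSet_Ioc fun s hs => ?_
          have : ⌈s / h⌉₊ = k + 1 := by
            rw [Nat.ceil_eq_iff (by omega)]
            rw [lt_div_iff₀ hh, div_le_iff₀ hh]
            exact ⟨by simpa using hs.1, hs.2⟩
          beta_reduce
          rw [this]
        rw [this, setIntegral_const, Real.volume_real_Ioc_of_le (by push_cast; nlinarith), smul_eq_mul]
        push_cast; ring
      rw [hsplit (k * h) _ hk0 (by push_cast; nlinarith), e1]
      have e2 := aux_taylor hφ hc2 h2 (X (k + 1) y) (h • v (k + 1) (X (k + 1) y))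
      rw [← H.X_step, map_smul, smul_eq_mul] at e2
      have e3 : ‖h • v (k + 1) (X (k + 1) y)‖ ≤ h * C₀ := by
        rw [norm_smul, Real.norm_of_nonneg hh.le]
        gcongr
        exact H.v_bdd _ _
      have e4 : |φ (X (k + 1) y) - φ (X k y) - h * g (k + 1)| ≤ c2 * (h * C₀) ^ 2 :=
        e2.trans (by gcongr)
      push_cast
      rw [abs_le] at e4 ih ⊢
      constructor <;> linarith [e4.1, e4.2, ih.1, ih.2]
  obtain ⟨c1, c3⟩ := aux_ceil2 hh ht.1
  have hkT := aux_ceil hh H.grid ht.2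
  have a1 := key ⌈t / h⌉₊
  rw [hsplit t _ ht.1 c1] at a1
  have a2 := norm_setIntegral_le_of_norm_le_const (μ := volume) (s := Ioc t (⌈t / h⌉₊ * h))
      (f := fun s => g ⌈s / h⌉₊) (C := c * C₀) (by simp) (fun s _ => hgb _)
  rw [Real.volume_real_Ioc_of_le c1, Real.norm_eq_abs] at a2
  have a3 : c * C₀ * (⌈t / h⌉₊ * h - t) ≤ c * C₀ * h := by gcongr; linarith
  have a4 : (⌈t / h⌉₊ : ℝ) * (c2 * (h * C₀) ^ 2) ≤ c2 * C₀ ^ 2 * T * h := by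
    have : (⌈t / h⌉₊ : ℝ) * (c2 * (h * C₀) ^ 2) = c2 * C₀ ^ 2 * (⌈t / h⌉₊ * h) * h := by ring
    rw [this]
    gcongr
  have a5 := a2.trans a3
  have a6 := a1.trans a4
  rw [abs_le] at a5 a6 ⊢
  constructor <;> linarith [a5.1, a5.2, a6.1, a6.2]

theorem aux_weak {T C₀ : ℝ} {b : ℝ → V → V} (hb : HalfLipschitzField d T b C₀)
    {L : ℝ≥0} {h K : ℕ → ℝ} {v Φ X : ℕ → ℕ → V → V} {Φl : ℝ → V → V}
    (A : Appr T C₀ b L h K v Φ X Φl) {Xl : ℝ → V → V} (hXm : ∀ s, Measurable (Xl s))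
    (hX : ∀ s ∈ Icc 0 T, (∀ᵐ y, Tendsto (fun n => X n ⌈s / h n⌉₊ y) atTop (𝓝 (Xl s y))) ∧
      ∀ᵐ y, Φl s (Xl s y) = y) {ν : Measure V} [IsProbabilityMeasure ν] {c0 : ℝ≥0}
    (hν : ν ≤ c0 • volume) {φ : V → ℝ} (hφ : ContDiff ℝ (⊤ : ℕ∞) φ) (hφs : HasCompactSupport φ)
    {t : ℝ} (ht : t ∈ Icc 0 T) :
    ∫ y, φ (Xl t y) ∂ν = (∫ y, φ y ∂ν) +
      ∫ s in Ioc 0 t, ∫ y, fderiv ℝ φ (Xl s y) (b s (Xl s y)) ∂ν := by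
  have hC := hb.pos.le
  obtain ⟨R, c, hR, hc, hf0, hfc, hfb⟩ := aux_cs hφ hφs
  obtain ⟨c2, hc2, h2⟩ : ∃ c2 : ℝ, 0 ≤ c2 ∧ ∀ x y, ‖fderiv ℝ φ x - fderiv ℝ φ y‖ ≤ c2 * ‖x - y‖ := by
    have hd : ContDiff ℝ 1 (fderiv ℝ φ) := hφ.fderiv_right (by norm_cast)
    obtain ⟨c2, h2⟩ := hd.lipschitzWith_of_hasCompactSupport (hφs.fderiv ℝ) (by simp)
    refine ⟨c2, c2.2, fun x y => ?_⟩
    have := h2.dist_le_mul x y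
    rwa [dist_eq_norm, dist_eq_norm] at this
  have hac : ν ≪ volume := (Measure.absolutelyContinuous_of_le hν).trans Measure.smul_absolutelyContinuous
  have hφd : Continuous (fderiv ℝ φ) := hφ.continuous_fderiv (by simp)
  have hIoc : Ioc 0 t ⊆ Icc 0 T := fun s hs => ⟨hs.1.le, hs.2.trans ht.2⟩
  let G : ℕ → ℝ → V → ℝ := fun n s y =>
    fderiv ℝ φ (X n ⌈s / h n⌉₊ y) (v n ⌈s / h n⌉₊ (X n ⌈s / h n⌉₊ y))
  have hGm : ∀ n, Measurable (Function.uncurry (G n)) := by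
    intro n
    have := aux_vmeas (v := fun k y => X n k y) (fun k => (A.E n).X_cont k) (h n)
    have h2 : Measurable fun z : ℝ × V => v n ⌈z.1 / h n⌉₊ (X n ⌈z.1 / h n⌉₊ z.2) :=
      (aux_vmeas (fun k => ((A.E n).v_smooth k).continuous) (h n)).comp (measurable_fst.prodMk this)
    have h3 : Continuous fun p : V × V => fderiv ℝ φ p.1 p.2 := 
      (hφd.comp continuous_fst).clm_apply continuous_snd
    exact h3.measurable.comp (this.prodMk h2)
  have hGb : ∀ n s y, ‖G n s y‖ ≤ c * C₀ := by
    intro n s y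
    refine (ContinuousLinearMap.le_opNorm _ _).trans ?_
    exact mul_le_mul (hfc _) ((A.E n).v_bdd _ _) (norm_nonneg _) hc
  have hGi : ∀ n, Integrable (Function.uncurry (G n)) ((volume.restrict (Ioc 0 t)).prod ν) := by
    intro n
    exact Integrable.of_bound (hGm n).aestronglyMeasurable (c * C₀) (Eventually.of_forall fun z => hGb n _ _)
  have hXnm : ∀ n k, Measurable (X n k) := fun n k => ((A.E n).X_cont k).measurable
  have hφi : ∀ {Y : V → V}, Measurable Y → Integrable (fun y => φ (Y y)) ν := by
    intro Y hY
    exact Integrable.of_bound (hφ.continuous.measurable.comp hY).aestronglyMeasurable c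
      (Eventually.of_forall fun y => hfb _)
  -- discrete identity
  have D : ∀ n, |(∫ y, φ (X n ⌈t / h n⌉₊ y) ∂ν) - (∫ y, φ y ∂ν) - ∫ s in Ioc 0 t, ∫ y, G n s y ∂ν| ≤
      (c2 * C₀ ^ 2 * T + c * C₀) * h n := by
    intro n
    rw [integral_integral_swap (hGi n)]
    have i1 := hφi (hXnm n ⌈t / h n⌉₊)
    have i2 : Integrable (fun y => φ y) ν := hφi measurable_id
    have i3 : Integrable (fun y => ∫ s in Ioc 0 t, G n s y) ν := (hGi n).integral_prod_right
    rw [← integral_sub i1 i2]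
    rw [← integral_sub (by exact i1.sub i2) i3]
    rw [← Real.norm_eq_abs]
    refine (norm_integral_le_of_norm_le_const (Eventually.of_forall fun y => ?_)).trans (by simp; rfl)
    exact aux_disc hC (A.E n) hφ hc hc2 hfc h2 y ht
  have T0 : Tendsto (fun n => (∫ y, φ (X n ⌈t / h n⌉₊ y) ∂ν) - (∫ y, φ y ∂ν) - ∫ s in Ioc 0 t, ∫ y, G n s y ∂ν)
      atTop (𝓝 0) := by
    rw [tendsto_zero_iff_norm_tendsto_zero]
    refine squeeze_zero (fun n => norm_nonneg _) D ?_
    simpa using A.h0.const_mul (c2 * C₀ ^ 2 * T + c * C₀)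
  have T1 : Tendsto (fun n => ∫ y, φ (X n ⌈t / h n⌉₊ y) ∂ν) atTop (𝓝 (∫ y, φ (Xl t y) ∂ν)) := by
    refine tendsto_integral_of_dominated_convergence (fun _ => c) ?_ (integrable_const _) ?_ ?_
    · exact fun n => (hφi (hXnm n _)).aestronglyMeasurable
    · exact fun n => Eventually.of_forall fun y => hfb _
    · filter_upwards [hac.ae_le (hX t ht).1] with y hy
      exact (hφ.continuous.tendsto _).comp hy
  have T2 : Tendsto (fun n => ∫ s in Ioc 0 t, ∫ y, G n s y ∂ν) atTop
      (𝓝 (∫ s in Ioc 0 t, ∫ y, fderiv ℝ φ (Xl s y) (b s (Xl s y)) ∂ν)) := by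
    refine tendsto_integral_of_dominated_convergence (fun _ => c * C₀) ?_ (integrable_const _) ?_ ?_
    · exact fun n => (hGi n).integral_prod_left.aestronglyMeasurable
    · refine fun n => Eventually.of_forall fun s => ?_
      exact (norm_integral_le_of_norm_le_const (Eventually.of_forall fun y => hGb n s y)).trans (by simp)
    · have hconv : ∀ᵐ s ∂(volume.restrict (Ioc 0 t)), ∀ᵐ x ∂(volume : Measure V),
          Tendsto (fun n => v n ⌈s / h n⌉₊ x) atTop (𝓝 (b s x)) :=
        ae_restrict_of_ae_restrict_of_subset (Ioc_subset_Ioc_right ht.2) A.conv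
      filter_upwards [hconv, ae_restrict_mem measurableSet_Ioc] with s hs hst
      have hsT := hIoc hst
      have hbm : Measurable (b s) := hb.meas.comp measurable_prodMk_left
      have h3 : Continuous fun p : V × V => fderiv ℝ φ p.1 p.2 := 
        (hφd.comp continuous_fst).clm_apply continuous_snd
      refine aux_conv (Y := fun n => X n ⌈s / h n⌉₊) (g := fun n x => fderiv ℝ φ x (v n ⌈s / h n⌉₊ x))
        (g' := fun x => fderiv ℝ φ x (b s x)) (R := R) (c := c * C₀) (a := c0 * L ^ d)
        (fun n => hXnm n _) (hXm s) ?_ ?_ (hac.ae_le (hX s hsT).1) ?_ ?_ ?_ ?_ ?_ ?_ ?_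
      · exact fun n => aux_law ((aux_phil_lip A hsT).1 n) (hXnm n _) (Eventually.of_forall ((A.E n).PhiX _)) hν
      · exact aux_law (aux_phil_lip A hsT).2 (hXm s) (hX s hsT).2 hν
      · exact fun n => h3.measurable.comp (measurable_id.prodMk ((A.E n).v_smooth _).continuous.measurable)
      · exact h3.measurable.comp (measurable_id.prodMk hbm)
      · intro n x
        rw [← Real.norm_eq_abs]
        refine (ContinuousLinearMap.le_opNorm _ _).trans ?_
        exact mul_le_mul (hfc _) ((A.E n).v_bdd _ _) (norm_nonneg _) hc
      · intro x
        rw [← Real.norm_eq_abs]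
        refine (ContinuousLinearMap.le_opNorm _ _).trans ?_
        exact mul_le_mul (hfc _) (hb.bdd s hsT x) (norm_nonneg _) hc
      · intro n x hx
        simp [(hf0 x hx).2]
      · intro x hx
        simp [(hf0 x hx).2]
      · filter_upwards [hs] with x hx
        exact ((fderiv ℝ φ x).continuous.tendsto _).comp hx
  have := tendsto_nhds_unique T0 ((T1.sub_const _).sub T2)
  linarith

theorem aux_existence {T C₀ : ℝ} {b : ℝ → V → V} (hb : HalfLipschitzField d T b C₀)
    {L : ℝ≥0} {h K : ℕ → ℝ} {v Φ X : ℕ → ℕ → V → V} {Φl : ℝ → V → V}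
    (A : Appr T C₀ b L h K v Φ X Φl) {ρ0 : V → ℝ} (hρ0 : IsProbDensity d ρ0) {C : ℝ}
    (hC : ∀ x, ρ0 x ≤ C) : ∃ ρ, IsCtyEqSolDet d T b ρ0 ρ := by
  have hi0 : Integrable ρ0 := by
    by_contra hc
    have := hρ0.2.2
    rw [integral_undef hc] at this
    simp at this
  obtain ⟨Xl, hXm, hX⟩ := aux_flow hb A
  set ν : Measure V := volume.withDensity fun x => ENNReal.ofReal (ρ0 x) with hνdef
  have hprob : IsProbabilityMeasure ν := by
    constructor
    rw [hνdef, withDensity_apply _ MeasurableSet.univ, setLIntegral_univ,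
      ← ofReal_integral_eq_lintegral_ofReal hi0 (Eventually.of_forall hρ0.2.1), hρ0.2.2, ENNReal.ofReal_one]
  have hν : ν ≤ (Real.toNNReal C) • volume := by
    have : ν ≤ volume.withDensity fun _ => ((Real.toNNReal C : ℝ≥0) : ℝ≥0∞) :=
      withDensity_mono (Eventually.of_forall fun x => ENNReal.ofReal_le_ofReal (hC x))
    rwa [withDensity_const] at this
  set a : ℝ≥0 := Real.toNNReal C * L ^ d with ha
  have hlaw : ∀ s ∈ Icc 0 T, ν.map (Xl s) ≤ a • volume := fun s hs =>
    aux_law (aux_phil_lip A hs).2 (hXm s) (hX s hs).2 hν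
  have hfin : ∀ s, IsFiniteMeasure (ν.map (Xl s)) := fun s => inferInstance
  have hint : ∀ s ∈ Icc 0 T, ∀ f : V → ℝ, Measurable f →
      ∫ x, f x * ((ν.map (Xl s)).rnDeriv volume x).toReal = ∫ y, f (Xl s y) ∂ν := by
    intro s hs f hf
    rw [(aux_dens (hlaw s hs)).2 f, integral_map (hXm s).aemeasurable hf.aestronglyMeasurable]
  refine ⟨fun s x => ((ν.map (Xl s)).rnDeriv volume x).toReal, ?_, ?_, ?_, ?_, ?_⟩
  · exact fun t => (Measure.measurable_rnDeriv _ _).ennreal_toReal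
  · exact fun t ht => Eventually.of_forall fun x => ENNReal.toReal_nonneg
  · refine ⟨a + 1, by positivity, fun t ht => ?_⟩
    filter_upwards [(aux_dens (hlaw t ht)).1] with x hx
    linarith
  · exact fun t ht => Measure.integrable_toReal_rnDeriv
  · intro φ hφ hφs t ht
    have hφd : Continuous (fderiv ℝ φ) := hφ.continuous_fderiv (by simp)
    rw [hint t ht φ hφ.continuous.measurable, aux_weak hb A hXm hX hν hφ hφs ht,
      aux_wd_int hρ0.1 (Eventually.of_forall hρ0.2.1)]
    congr 1
    refine setIntegral_congr_fun measurableSet_Ioc fun s hs => ?_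
    have hbm : Measurable (b s) := hb.meas.comp measurable_prodMk_left
    have h3 : Continuous fun p : V × V => fderiv ℝ φ p.1 p.2 := 
      (hφd.comp continuous_fst).clm_apply continuous_snd
    have := hint s ⟨hs.1.le, hs.2.trans ht.2⟩ (fun x => fderiv ℝ φ x (b s x))
      (h3.measurable.comp (measurable_id.prodMk hbm))
    beta_reduce
    rw [← this]
    simp
end helpers12

/-- Proposition A.1 / `prop.appen`: if `b` is a bounded Borel vector
field satisfying the half-Lipschitz condition from below and `m̄₀ ∈ P₁(ℝ^d)` is
absolutely continuous with bounded density, then the forward continuity equation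
`∂_t m + div(mb) = 0`, `m(0) = m̄₀`, has a unique bounded absolutely continuous
distributional solution. -/
theorem continuity_equation_wellposed_halfLipschitz
    (T : ℝ) (hT : 0 < T) (b : ℝ → V → V) (C₀ : ℝ)
    (hb : HalfLipschitzField d T b C₀)
    (ρ0 : V → ℝ) (hρ0 : IsProbDensity d ρ0)
    (hρ0bdd : ∃ C : ℝ, 0 < C ∧ ∀ x, ρ0 x ≤ C)
    (hρ0mom : Integrable (fun x : V => ‖x‖ * ρ0 x)) :
    ∃ ρ : ℝ → V → ℝ, IsCtyEqSolDet d T b ρ0 ρ ∧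
      ∀ ρ' : ℝ → V → ℝ, IsCtyEqSolDet d T b ρ0 ρ' →
        ∀ t ∈ Icc (0:ℝ) T,
          (fun x : V => ρ t x) =ᵐ[(volume : Measure V)] fun x : V => ρ' t x := by
  obtain ⟨L, h, K, v, Φ, X, Φl, a1, a2, a3, a4, a5⟩ := aux_approx hT hb
  have A : Appr T C₀ b L h K v Φ X Φl := ⟨a1, a2, a3, a4, a5⟩
  obtain ⟨C, -, hC⟩ := hρ0bdd
  obtain ⟨ρ, hρ⟩ := aux_existence hb A hρ0 hC
  exact ⟨ρ, hρ, fun ρ' hρ' t ht => aux_uniqueness hT hb A hρ0 hρ hρ' ht⟩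
end
end

section
/- Let b: [0,T]×ℝ^d → ℝ^d be a bounded Borel vector field satisfying the half-Lipschitz condition from below, and let X(x₀,t₀,·) denote the unique backward Filippov flow. Then, for any 0 ≤ t ≤ t₀ ≤ T, the map x ↦ X(x, t₀, t) is surjective from ℝ^d onto ℝ^d. -/
open MeasureTheory Filter Set
open scoped ENNReal NNReal Topology RealInnerProductSpace

noncomputable section

variable (d : ℕ)

local notation "V" => EuclideanSpace ℝ (Fin d)

lemma filippov_subset (b : ℝ → V → V) (t : ℝ) (x : V) {δ : ℝ} (hδ : 0 < δ) :
    filippov d b t x ⊆ closure (convexHull ℝ (b t '' (Metric.ball x δ))) := by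
  intro g hg
  have h := mem_iInter₂.1 hg δ hδ
  have h2 := mem_iInter₂.1 h ∅ (by simp)
  simpa using h2

lemma filippov_norm_le {T : ℝ} {b : ℝ → V → V} {C : ℝ} (hb : HalfLipschitzField d T b C)
    {t : ℝ} (ht : t ∈ Icc (0:ℝ) T) {x g : V} (hg : g ∈ filippov d b t x) : ‖g‖ ≤ C := by
  have h := filippov_subset d b t x one_pos hg
  have h2 : closure (convexHull ℝ (b t '' (Metric.ball x 1))) ⊆ Metric.closedBall (0:V) C := by
    refine closure_minimal (convexHull_min ?_ (convex_closedBall _ _)) Metric.isClosed_closedBall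
    rintro _ ⟨z, _, rfl⟩
    simpa using hb.bdd t ht z
  simpa using h2 h

lemma filippov_mono {T : ℝ} {b : ℝ → V → V} {C : ℝ} (hb : HalfLipschitzField d T b C)
    {t : ℝ} (ht : t ∈ Icc (0:ℝ) T) {x g : V} (hg : g ∈ filippov d b t x) (w : V) :
    -C * ‖x - w‖ ^ 2 ≤ ⟪g - b t w, x - w⟫ := by
  have hC := hb.pos
  have key : ∀ δ : ℝ, 0 < δ →
      -C * (‖x - w‖ + δ) ^ 2 - 2 * C * δ + ⟪b t w, x - w⟫ ≤ ⟪x - w, g⟫ := by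
    intro δ hδ
    have h := filippov_subset d b t x hδ hg
    have h2 : closure (convexHull ℝ (b t '' (Metric.ball x δ))) ⊆
        {v : V | -C * (‖x - w‖ + δ) ^ 2 - 2 * C * δ + ⟪b t w, x - w⟫ ≤ ⟪x - w, v⟫} := by
      refine closure_minimal (convexHull_min ?_ ?_) ?_
      · rintro _ ⟨z, hz, rfl⟩
        have hz' : ‖z - x‖ < δ := by simpa [dist_eq_norm] using hz
        have h1 := hb.halfLip t ht z w
        have h3 : ‖z - w‖ ≤ ‖x - w‖ + δ := by
          have : z - w = (x - w) + (z - x) := by abel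
          rw [this]
          exact (norm_add_le _ _).trans (by linarith)
        have h4 : ‖z - w‖ ^ 2 ≤ (‖x - w‖ + δ) ^ 2 := by gcongr
        have h5 : ⟪b t z - b t w, z - w⟫ =
            ⟪b t z - b t w, x - w⟫ + ⟪b t z - b t w, z - x⟫ := by
          rw [← inner_add_right]; congr 1; abel
        have h6 : ⟪b t z - b t w, z - x⟫ ≤ (2 * C) * δ := by
          refine (real_inner_le_norm _ _).trans ?_
          have := norm_sub_le (b t z) (b t w)
          have := hb.bdd t ht z
          have := hb.bdd t ht w
          gcongr
          linarith
        have h7 : ⟪b t z - b t w, x - w⟫ = ⟪x - w, b t z⟫ - ⟪b t w, x - w⟫ := by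
          rw [inner_sub_left, real_inner_comm]
        simp only [mem_setOf_eq]
        nlinarith
      · exact convex_halfSpace_ge (f := fun v : V => ⟪x - w, v⟫)
          ⟨fun a c => inner_add_right _ _ _, fun a c => by simp [inner_smul_right]⟩ _
      · exact isClosed_le continuous_const (by fun_prop)
    exact h2 h
  have hlim : Tendsto (fun δ : ℝ => -C * (‖x - w‖ + δ) ^ 2 - 2 * C * δ + ⟪b t w, x - w⟫)
      (𝓝[>] 0) (𝓝 (-C * (‖x - w‖ + 0) ^ 2 - 2 * C * 0 + ⟪b t w, x - w⟫)) := by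
    apply Tendsto.mono_left _ nhdsWithin_le_nhds
    apply Continuous.tendsto
    fun_prop
  have := le_of_tendsto hlim (by
    filter_upwards [self_mem_nhdsWithin] with δ hδ using key δ hδ)
  rw [inner_sub_left, real_inner_comm (x - w) g]
  linarith

/-- One Euler step compared with a Filippov trajectory. -/
lemma euler_step {T : ℝ} {b : ℝ → V → V} {C : ℝ} (hb : HalfLipschitzField d T b C)
    {x g : ℝ → V} {t₀ : ℝ} (ht₀ : t₀ ∈ Icc (0:ℝ) T)
    (hgi : IntegrableOn g (Ioc 0 t₀))
    (hg : ∀ᵐ s ∂(volume.restrict (Ioc 0 t₀)), g s ∈ filippov d b s (x s))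
    (hx : ∀ t ∈ Icc 0 t₀, x t = x 0 + ∫ s in Ioc 0 t, g s)
    {s₀ s₁ : ℝ} (h0 : 0 ≤ s₀) (h01 : s₀ ≤ s₁) (h1 : s₁ ≤ t₀) (w : V) :
    (1 - 4 * C * (s₁ - s₀)) * ‖x s₀ - w‖ ^ 2 ≤
      ‖x s₁ - (w + ∫ r in Ioc s₀ s₁, b r w)‖ ^ 2
        + 4 * C ^ 2 * (s₁ - s₀) ^ 2 + 4 * C ^ 3 * (s₁ - s₀) ^ 3 := by
  have hC := hb.pos
  have hsub : ∀ s ∈ Icc s₀ s₁, x s = x s₀ + ∫ r in Ioc s₀ s, g r := by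
    intro s hs
    rw [hx s ⟨h0.trans hs.1, hs.2.trans h1⟩, hx s₀ ⟨h0, h01.trans h1⟩, add_assoc,
      ← setIntegral_union (Ioc_disjoint_Ioc_of_le le_rfl) measurableSet_Ioc
        (hgi.mono_set (Ioc_subset_Ioc_right (h01.trans h1)))
        (hgi.mono_set (Ioc_subset_Ioc h0 (hs.2.trans h1))), Ioc_union_Ioc_eq_Ioc h0 hs.1]
  have hgi' : IntegrableOn g (Ioc s₀ s₁) := hgi.mono_set (Ioc_subset_Ioc h0 h1)
  have hg' : ∀ᵐ s ∂(volume.restrict (Ioc s₀ s₁)), g s ∈ filippov d b s (x s) :=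
    ae_restrict_of_ae_restrict_of_subset (Ioc_subset_Ioc h0 h1) hg
  have hT : ∀ s ∈ Ioc s₀ s₁, s ∈ Icc (0:ℝ) T := fun s hs =>
    ⟨h0.trans hs.1.le, hs.2.trans (h1.trans ht₀.2)⟩
  have hgn : ∀ᵐ s ∂(volume.restrict (Ioc s₀ s₁)), ‖g s‖ ≤ C := by
    filter_upwards [hg', ae_restrict_mem measurableSet_Ioc] with s hs hs'
    exact filippov_norm_le d hb (hT s hs') hs
  have hhi : IntegrableOn (fun r => b r w) (Ioc s₀ s₁) := by
    refine Measure.integrableOn_of_bounded (M := C) (by simp) ?_ ?_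
    · exact (hb.meas.comp (measurable_id.prodMk measurable_const)).aestronglyMeasurable
    · filter_upwards [ae_restrict_mem measurableSet_Ioc] with s hs'
      exact hb.bdd s (hT s hs') w
  have hxd : ∀ s ∈ Ioc s₀ s₁, ‖x s - x s₀‖ ≤ C * (s₁ - s₀) := by
    intro s hs
    rw [hsub s ⟨hs.1.le, hs.2⟩, add_sub_cancel_left]
    have := norm_setIntegral_le_of_norm_le_const_ae (μ := volume) (s := Ioc s₀ s) (f := g)
      (C := C) (by simp)
      (ae_restrict_of_ae_restrict_of_subset (Ioc_subset_Ioc_right hs.2) hgn)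
    refine this.trans ?_
    rw [Real.volume_real_Ioc_of_le hs.1.le]
    have := hs.2
    gcongr
  set D := ∫ r in Ioc s₀ s₁, (g r - b r w) with hD
  have hDe : x s₁ - (w + ∫ r in Ioc s₀ s₁, b r w) = (x s₀ - w) + D := by
    rw [hD, integral_sub hgi' hhi, hsub s₁ ⟨h01, le_rfl⟩]; abel
  have hin : ⟪x s₀ - w, D⟫ = ∫ r in Ioc s₀ s₁, ⟪x s₀ - w, g r - b r w⟫ := by
    rw [hD]; exact (integral_inner (hgi'.sub hhi) _).symm
  set η := s₁ - s₀ with hη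
  have hη0 : 0 ≤ η := sub_nonneg.2 h01
  set E := ‖x s₀ - w‖ with hE
  have hpt : ∀ᵐ s ∂(volume.restrict (Ioc s₀ s₁)),
      -(C * (2 * E ^ 2 + 2 * (C * η) ^ 2) + 2 * C * (C * η)) ≤ ⟪x s₀ - w, g s - b s w⟫ := by
    filter_upwards [hg', hgn, ae_restrict_mem measurableSet_Ioc] with s hs hn hs'
    have m := filippov_mono d hb (hT s hs') hs w
    have e1 : ⟪g s - b s w, x s - w⟫ = ⟪x s₀ - w, g s - b s w⟫ + ⟪g s - b s w, x s - x s₀⟫ := by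
      rw [real_inner_comm (g s - b s w) (x s₀ - w), ← inner_add_right]; congr 1; abel
    have e2 : ⟪g s - b s w, x s - x s₀⟫ ≤ (2 * C) * (C * η) := by
      refine (real_inner_le_norm _ _).trans ?_
      have := norm_sub_le (g s) (b s w)
      have := hb.bdd s (hT s hs') w
      have := hxd s hs'
      gcongr
      linarith
    have e3 : ‖x s - w‖ ≤ E + C * η := by
      have : x s - w = (x s₀ - w) + (x s - x s₀) := by abel
      rw [this]
      exact (norm_add_le _ _).trans (by linarith [hxd s hs'])
    have e4 : ‖x s - w‖ ^ 2 ≤ 2 * E ^ 2 + 2 * (C * η) ^ 2 := by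
      have : ‖x s - w‖ ^ 2 ≤ (E + C * η) ^ 2 := by gcongr
      nlinarith [sq_nonneg (E - C * η)]
    have e5 := mul_le_mul_of_nonneg_left e4 hC.le
    linarith
  have hint : -(C * (2 * E ^ 2 + 2 * (C * η) ^ 2) + 2 * C * (C * η)) * η ≤ ⟪x s₀ - w, D⟫ := by
    rw [hin]
    have := integral_mono_ae (μ := volume.restrict (Ioc s₀ s₁)) (integrable_const _)
      ((hgi'.sub hhi).const_inner (x s₀ - w)) hpt
    refine le_trans (le_of_eq ?_) this
    rw [setIntegral_const, Real.volume_real_Ioc_of_le h01, smul_eq_mul, mul_comm]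
  rw [hDe, norm_add_sq_real]
  nlinarith [sq_nonneg ‖D‖]

/-- Euler polygon with step `η` starting from `y` at time `t`. -/
def eulerSeq (b : ℝ → V → V) (t η : ℝ) (y : V) : ℕ → V
  | 0 => y
  | k + 1 => eulerSeq b t η y k +
      ∫ r in Ioc (t + k * η) (t + (k + 1 : ℕ) * η), b r (eulerSeq b t η y k)

/-- Lemma A.2 / `lem.inject`: if `b` is a bounded Borel vector field
satisfying the half-Lipschitz condition from below and `X` is the backward Filippov flow
of `b`, then for any `0 ≤ t ≤ t₀ ≤ T` the map `x ↦ X(x, t₀, t)` is surjective. -/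
theorem backward_filippov_flow_surjective
    (T : ℝ) (hT : 0 < T) (b : ℝ → V → V) (C₀ : ℝ)
    (hb : HalfLipschitzField d T b C₀)
    (X : V → ℝ → ℝ → V) (hX : IsBackwardFilippovFlow d T b X) :
    ∀ t₀ ∈ Icc (0:ℝ) T, ∀ t ∈ Icc (0:ℝ) t₀,
      Function.Surjective fun x : V => X x t₀ t := by
  intro t₀ ht₀ t ht y
  have hC := hb.pos
  set L := t₀ - t with hL
  have hL0 : 0 ≤ L := sub_nonneg.2 ht.2
  let η : ℕ → ℝ := fun n => L / n
  let z : ℕ → V := fun n => eulerSeq d b t (η n) y n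
  have hη0 : ∀ n, 0 ≤ η n := fun n => by positivity
  have hηn : ∀ n : ℕ, n ≠ 0 → n * η n = L := fun n hn => by
    simp only [η]; field_simp
  have hle : ∀ n k : ℕ, k ≤ n → t + k * η n ≤ t₀ := by
    intro n k hk
    rcases eq_or_ne n 0 with rfl | hn
    · have : k = 0 := by omega
      subst this; simpa using ht.2
    · have h1 := hηn n hn
      have h2 : (k : ℝ) * η n ≤ n * η n :=
        mul_le_mul_of_nonneg_right (by exact_mod_cast hk) (hη0 n)
      linarith
  have hge : ∀ n k : ℕ, 0 ≤ t + k * η n := fun n k =>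
    add_nonneg ht.1 (mul_nonneg k.cast_nonneg (hη0 n))
  have hstep : ∀ n k : ℕ, t + ((k + 1 : ℕ) : ℝ) * η n - (t + k * η n) = η n := by
    intro n k; push_cast; ring
  have hbd : ∀ n k : ℕ, k ≤ n → ‖eulerSeq d b t (η n) y k - y‖ ≤ C₀ * (k * η n) := by
    intro n k
    induction k with
    | zero => intro _; simp [eulerSeq]
    | succ k ih =>
      intro hk
      have ih' := ih (by omega)
      have hm : t + k * η n ≤ t + ((k + 1 : ℕ) : ℝ) * η n := by linarith [hstep n k, hη0 n]
      have := norm_setIntegral_le_of_norm_le_const (μ := volume)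
        (s := Ioc (t + k * η n) (t + ((k + 1 : ℕ) : ℝ) * η n))
        (f := fun r => b r (eulerSeq d b t (η n) y k)) (C := C₀) (by simp)
        (fun r hr => hb.bdd r ⟨(hge n k).trans hr.1.le,
          hr.2.trans ((hle n (k+1) hk).trans ht₀.2)⟩ _)
      rw [Real.volume_real_Ioc_of_le hm, hstep] at this
      rw [eulerSeq, add_sub_right_comm]
      refine (norm_add_le _ _).trans ?_
      push_cast at this ⊢
      linarith
  have hzb : ∀ n, z n ∈ Metric.closedBall y (C₀ * L) := by
    intro n
    rw [mem_closedBall_iff_norm]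
    refine (hbd n n le_rfl).trans ?_
    have := hle n n le_rfl
    gcongr
    linarith
  obtain ⟨x₀, -, φ, hφ, hlim⟩ := (isCompact_closedBall y (C₀ * L)).tendsto_subseq hzb
  refine ⟨x₀, ?_⟩
  obtain ⟨⟨g, hgi, hg, hx⟩, hend⟩ := hX x₀ t₀ ht₀
  set x := X x₀ t₀ with hxdef
  set K := 4 * C₀ ^ 2 + 4 * C₀ ^ 3 * L with hK
  have main : ∀ n : ℕ, n ≠ 0 → 4 * C₀ * η n ≤ 1 →
      (1 - 4 * C₀ * η n) ^ n * ‖x t - y‖ ^ 2 ≤ ‖x₀ - z n‖ ^ 2 + K * L * η n := by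
    intro n hn hsm
    have hηL : η n ≤ L := by
      have := hle n 1 (by omega)
      push_cast at this; linarith
    have aux : ∀ k : ℕ, k ≤ n → (1 - 4 * C₀ * η n) ^ k * ‖x t - y‖ ^ 2 ≤
        ‖x (t + k * η n) - eulerSeq d b t (η n) y k‖ ^ 2 + k * (K * η n ^ 2) := by
      intro k
      induction k with
      | zero => intro _; simp [eulerSeq]
      | succ k ih =>
        intro hk
        have ih' := ih (by omega)
        have hm : t + k * η n ≤ t + ((k + 1 : ℕ) : ℝ) * η n := by linarith [hstep n k, hη0 n]
        have st := euler_step d hb ht₀ hgi hg hx (hge n k) hm (hle n (k+1) hk)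
          (eulerSeq d b t (η n) y k)
        rw [hstep] at st
        rw [show eulerSeq d b t (η n) y (k+1) = eulerSeq d b t (η n) y k +
          ∫ r in Ioc (t + k * η n) (t + (k + 1 : ℕ) * η n), b r (eulerSeq d b t (η n) y k)
          from rfl]
        have h1 := mul_le_mul_of_nonneg_left ih' (sub_nonneg.2 hsm)
        have hA : 0 ≤ k * (K * η n ^ 2) := by positivity
        have h2 : (1 - 4 * C₀ * η n) * (k * (K * η n ^ 2)) ≤ k * (K * η n ^ 2) := by
          have : 0 ≤ 4 * C₀ * η n := by have := hη0 n; positivity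
          nlinarith
        have h3 : 4 * C₀ ^ 3 * η n ^ 3 ≤ 4 * C₀ ^ 3 * (L * η n ^ 2) := by
          have := hη0 n
          rw [pow_succ' (η n)]
          gcongr
        have h4 : ((k + 1 : ℕ) : ℝ) * (K * η n ^ 2) = k * (K * η n ^ 2)
          + (4 * C₀ ^ 2 * η n ^ 2 + 4 * C₀ ^ 3 * (L * η n ^ 2)) := by
          rw [hK]; push_cast; ring
        rw [pow_succ', h4, mul_assoc]
        rw [mul_add] at h1
        linarith
    have := aux n le_rfl
    rw [hηn n hn, show t + L = t₀ by rw [hL]; ring, hend] at this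
    refine this.trans (le_of_eq ?_)
    rw [show (n:ℝ) * (K * η n ^ 2) = K * (n * η n) * η n by ring, hηn n hn]
  have hηlim : Tendsto η atTop (𝓝 0) := tendsto_const_div_atTop_nhds_zero_nat L
  have hexp : Tendsto (fun n : ℕ => (1 - 4 * C₀ * η n) ^ n) atTop
      (𝓝 (Real.exp (-(4 * C₀ * L)))) := by
    refine (Real.tendsto_one_add_div_pow_exp (-(4 * C₀ * L))).congr fun n => ?_
    simp only [η]; congr 1; ring
  have hl := (hexp.mul_const (‖x t - y‖ ^ 2)).comp hφ.tendsto_atTop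
  have hr : Tendsto (fun n => ‖x₀ - z (φ n)‖ ^ 2 + K * L * η (φ n)) atTop
      (𝓝 (‖x₀ - x₀‖ ^ 2 + K * L * 0)) :=
    ((tendsto_const_nhds.sub hlim).norm.pow 2).add
      ((hηlim.comp hφ.tendsto_atTop).const_mul _)
  have hsmall : ∀ᶠ n in atTop, 4 * C₀ * η n ≤ 1 := by
    have : Tendsto (fun n => 4 * C₀ * η n) atTop (𝓝 (4 * C₀ * 0)) := hηlim.const_mul _
    exact this.eventually_le_const (by simp)
  have hfin := le_of_tendsto_of_tendsto hl hr (by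
    filter_upwards [hφ.tendsto_atTop.eventually hsmall,
      hφ.tendsto_atTop.eventually (eventually_ne_atTop 0)] with n h1 h2
    exact main (φ n) h2 h1)
  have hp := Real.exp_pos (-(4 * C₀ * L))
  simp only [sub_self, norm_zero, mul_zero, add_zero, ne_eq, OfNat.ofNat_ne_zero,
    not_false_eq_true, zero_pow] at hfin
  have h0 : ‖x t - y‖ ^ 2 ≤ 0 := by
    by_contra hcon
    push Not at hcon
    exact absurd (mul_pos hp hcon) (not_lt.2 hfin)
  have h1 : ‖x t - y‖ = 0 := by
    have := sq_nonneg ‖x t - y‖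
    exact pow_eq_zero_iff (two_ne_zero) |>.1 (le_antisymm h0 this)
  exact sub_eq_zero.1 (norm_eq_zero.1 h1)
end
end
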